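/- Let p be a prime, q = p^{2s} an even power of p with √q = p^s > 4, and let α be a real number with 2/(√q − 2) < α < 1/2 + 1/(√q − 2). Then for every ε > 0 and every N there exist n ≥ N, a vector w : Fin n → 𝔽_q with all wᵢ ≠ 0, and an 𝔽_q-linear code C ⊆ 𝔽_qⁿ such that: (i) C_w^⊥ := {x : Σᵢ wᵢ xᵢ yᵢ = 0 for all y ∈ C} ⊆ C; (ii) dim_{𝔽_q} C ≥ (1 − α + 1/(√q − 2) − ε)·n; and (iii) every nonzero codeword of C has Hamming weight ≥ (α − 2/(√q − 2) − ε)·n. -/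

import Mathlib

namespace GSTower

/-- The additive polynomial `z ^ r + z`. -/
def S (r : ℕ) {R : Type*} [CommRing R] (z : R) : R := z ^ r + z

/-- An infinite sequence satisfying the Garcia–Stichtenoth relations, with `S (ξ 0) ≠ 0`. -/
structure IsPoint {L : Type*} [Field L] (r : ℕ) (ξ : ℕ → L) : Prop where
  ne : S r (ξ 0) ≠ 0
  rel : ∀ l, S r (ξ (l + 1)) * S r (ξ l) = ξ l ^ (r + 1)

section Field

variable {L : Type*} [Field L] {r : ℕ} {ξ : ℕ → L}

theorem S_eq_mul (hr : 1 ≤ r) (z : L) : S r z = z * (z ^ (r - 1) + 1) := by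
  obtain ⟨k, rfl⟩ := Nat.exists_eq_add_of_le' hr
  simp [S]; ring

theorem S_zero (hr : 1 ≤ r) : S r (0 : L) = 0 := by
  rw [S_eq_mul hr, zero_mul]

theorem S_add (hadd : ∀ a b : L, (a + b) ^ r = a ^ r + b ^ r) (a b : L) :
    S r (a + b) = S r a + S r b := by
  simp only [S, hadd]; ring

theorem S_sub (hadd : ∀ a b : L, (a + b) ^ r = a ^ r + b ^ r) (a b : L) :
    S r (a - b) = S r a - S r b := by
  have := S_add hadd (a - b) b
  rw [sub_add_cancel] at this
  rw [this]; ring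

theorem S_mul_of_pow_eq {c : L} (hc : c ^ r = c) (z : L) : S r (c * z) = c * S r z := by
  simp only [S, mul_pow, hc]; ring

theorem IsPoint.ne_zero_of_S (hr : 1 ≤ r) {z : L} (h : S r z ≠ 0) : z ≠ 0 := by
  rintro rfl; exact h (S_zero hr)

theorem IsPoint.S_ne (hξ : IsPoint r ξ) (hr : 1 ≤ r) (l : ℕ) : S r (ξ l) ≠ 0 := by
  induction l with
  | zero => exact hξ.ne
  | succ l ih =>
    intro h
    have := hξ.rel l
    rw [h, zero_mul] at this
    exact IsPoint.ne_zero_of_S hr ih (pow_eq_zero_iff (by omega) |>.1 this.symm)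

theorem IsPoint.ne_zero (hξ : IsPoint r ξ) (hr : 1 ≤ r) (l : ℕ) : ξ l ≠ 0 :=
  IsPoint.ne_zero_of_S hr (hξ.S_ne hr l)

theorem IsPoint.S_succ (hξ : IsPoint r ξ) (hr : 1 ≤ r) (l : ℕ) :
    S r (ξ (l + 1)) = ξ l ^ (r + 1) / S r (ξ l) := by
  rw [eq_div_iff (hξ.S_ne hr l), hξ.rel]

theorem IsPoint.S_inv (hξ : IsPoint r ξ) (hr : 1 ≤ r) (l : ℕ) :
    S r (1 / ξ l) = 1 / S r (ξ (l + 1)) := by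
  have h0 := hξ.ne_zero hr l
  have h1 := hξ.S_ne hr l
  rw [hξ.S_succ hr, one_div_div, eq_div_iff (pow_ne_zero _ h0)]
  simp only [S, one_div, inv_pow]
  field_simp
  ring

end Field

section Valuation

variable {L : Type*} [Field L] {r : ℕ} {ξ : ℕ → L}
variable {Γ : Type*} [LinearOrderedCommGroupWithZero Γ] (v : Valuation L Γ)

theorem v_S_of_lt (hr : 2 ≤ r) {z : L} (h : v z < 1) : v (S r z) = v z := by
  rw [S_eq_mul (by omega), map_mul, add_comm, v.map_one_add_of_lt, mul_one]
  rw [map_pow]; exact pow_lt_one₀ zero_le h (by omega)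

theorem v_S_of_gt (hr : 2 ≤ r) {z : L} (h : 1 < v z) : v (S r z) = v z ^ r := by
  rw [S, v.map_add_eq_of_lt_left, map_pow]
  rw [map_pow]
  calc v z = v z ^ 1 := (pow_one _).symm
    _ < v z ^ r := pow_lt_pow_right₀ h (by omega)

theorem v_S_le {z : L} (h : v z ≤ 1) : v (S r z) ≤ 1 :=
  v.map_add_le (by rw [map_pow]; exact pow_le_one₀ zero_le h) h

theorem v_le_of_S_le (hr : 2 ≤ r) {z : L} (h : v (S r z) ≤ 1) : v z ≤ 1 := by
  by_contra! hz
  rw [v_S_of_gt v hr hz] at h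
  exact absurd h (not_le.2 (one_lt_pow₀ hz (by omega)))

theorem v_pow_of_S_gt (hr : 2 ≤ r) {z : L} (h : 1 < v (S r z)) : v z ^ r = v (S r z) := by
  refine (v_S_of_gt v hr ?_).symm
  by_contra! hz
  exact absurd (v_S_le v hz) (not_le.2 h)

theorem IsPoint.v_rel (hξ : IsPoint r ξ) (l : ℕ) :
    v (S r (ξ (l + 1))) * v (S r (ξ l)) = v (ξ l) ^ (r + 1) := by
  rw [← map_mul, hξ.rel, map_pow]

theorem IsPoint.v_S_succ_of_lt (hξ : IsPoint r ξ) (hr : 2 ≤ r) {l : ℕ} (h : v (ξ l) < 1) :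
    v (S r (ξ (l + 1))) = v (S r (ξ l)) ^ r := by
  have := hξ.v_rel v l
  rw [v_S_of_lt v hr h, pow_succ] at this
  rw [v_S_of_lt v hr h]
  exact mul_right_cancel₀ (v.ne_zero_iff.2 (hξ.ne_zero (by omega) l)) this

theorem IsPoint.v_succ_of_gt (hξ : IsPoint r ξ) (hr : 2 ≤ r) {l : ℕ} (h : 1 < v (ξ l)) :
    v (ξ (l + 1)) ^ r = v (ξ l) := by
  have h1 := hξ.v_rel v l
  rw [v_S_of_gt v hr h, pow_succ, mul_comm] at h1
  have h2 := mul_left_cancel₀ (pow_ne_zero r (v.ne_zero_iff.2 (hξ.ne_zero (by omega) l))) h1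
  rw [v_pow_of_S_gt v hr (by rw [h2]; exact h), h2]

theorem one_lt_of_one_lt_pow {Γ : Type*} [LinearOrderedCommGroupWithZero Γ] {a : Γ} {n : ℕ}
    (h : 1 < a ^ n) : 1 < a := by
  by_contra! ha
  exact absurd (pow_le_one₀ zero_le ha) (not_le.2 h)

theorem IsPoint.v_gt_of_gt (hξ : IsPoint r ξ) (hr : 2 ≤ r) {l : ℕ} (h : 1 < v (ξ l)) :
    1 < v (ξ (l + 1)) :=
  one_lt_of_one_lt_pow (n := r) (by rw [hξ.v_succ_of_gt v hr h]; exact h)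

theorem IsPoint.v_eq_one (hξ : IsPoint r ξ) (hr : 2 ≤ r) (h0 : v (ξ 0) ≤ 1)
    (h : v (S r (ξ 0)) = 1) (l : ℕ) : v (ξ l) = 1 := by
  have key : ∀ z : L, v z ≤ 1 → v (S r z) = 1 → v z = 1 := by
    intro z h1 h2
    refine le_antisymm h1 ?_
    by_contra! h3
    rw [v_S_of_lt v hr h3] at h2
    exact h3.ne h2
  suffices v (ξ l) = 1 ∧ v (S r (ξ l)) = 1 from this.1
  induction l with
  | zero => exact ⟨key _ h0 h, h⟩
  | succ l ih =>
    have := hξ.v_rel v l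
    rw [ih.1, ih.2, mul_one, one_pow] at this
    exact ⟨key _ (v_le_of_S_le v hr this.le) this, this⟩

/-- The local behaviour of a point at a place above a zero of `S (ξ 0)`: the coordinates before
index `i` vanish, and the `i`-th one reduces to the root `β` of `S`. -/
structure HasType (r : ℕ) (ξ : ℕ → L) (i : ℕ) (β : L) : Prop where
  lt : ∀ l < i, v (ξ l) < 1
  sub_lt : v (ξ i - β) < 1
  root : S r β = 0

variable {v} {i m : ℕ} {β : L}

theorem HasType.v_beta_le (h : HasType v r ξ i β) (hr : 2 ≤ r) : v β ≤ 1 :=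
  v_le_of_S_le v hr (by rw [h.root, map_zero]; exact zero_le_one)

theorem v_root_eq_one (v : Valuation L Γ) (hr : 2 ≤ r) (hS : S r β = 0) (hβ : β ≠ 0) :
    v β = 1 := by
  rw [S_eq_mul (by omega), mul_eq_zero, or_iff_right hβ] at hS
  have : v β ^ (r - 1) = 1 := by
    rw [← map_pow, eq_neg_of_add_eq_zero_left hS, Valuation.map_neg, map_one]
  exact (pow_eq_one_iff_of_nonneg zero_le (by omega)).1 this

theorem HasType.v_S (h : HasType v r ξ i β) (hr : 2 ≤ r)
    (hadd : ∀ a b : L, (a + b) ^ r = a ^ r + b ^ r) : v (S r (ξ i)) = v (ξ i - β) := by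
  rw [← v_S_of_lt v hr h.sub_lt, S_sub hadd, h.root, sub_zero]

theorem HasType.v_S_pow (h : HasType v r ξ i β) (hξ : IsPoint r ξ) (hr : 2 ≤ r) {l : ℕ}
    (hl : l ≤ i) : v (S r (ξ l)) = v (S r (ξ 0)) ^ r ^ l := by
  induction l with
  | zero => simp
  | succ l ih => rw [hξ.v_S_succ_of_lt v hr (h.lt l (by omega)), ih (by omega), ← pow_mul, pow_succ]

theorem HasType.v_S_zero_lt (h : HasType v r ξ i β) (hξ : IsPoint r ξ) (hr : 2 ≤ r)
    (hadd : ∀ a b : L, (a + b) ^ r = a ^ r + b ^ r) : v (S r (ξ 0)) < 1 := by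
  have h1 := h.v_S hr hadd
  rw [h.v_S_pow hξ hr le_rfl] at h1
  by_contra! h2
  exact absurd (one_le_pow₀ h2 (n := r ^ i)) (not_le.2 (h1 ▸ h.sub_lt))

theorem exists_root_sub_lt (v : Valuation L Γ) {Ω : Finset L}
    (hΩ : ∀ z : L, S r z = ∏ ω ∈ Ω, (z - ω)) {z : L} (h : v (S r z) < 1) :
    ∃ β ∈ Ω, v (z - β) < 1 := by
  by_contra! h1
  rw [hΩ, map_prod] at h
  exact absurd (Finset.one_le_prod' (s := Ω) (f := fun ω => v (z - ω)) h1) (not_le.2 h)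

theorem exists_hasType (v : Valuation L Γ) {Ω : Finset L}
    (hΩ : ∀ z : L, S r z = ∏ ω ∈ Ω, (z - ω)) (hξ : IsPoint r ξ) (hr : 2 ≤ r)
    (h : v (S r (ξ 0)) < 1) (m : ℕ) :
    ∃ i ≤ m, ∃ β ∈ Ω, HasType v r ξ i β ∧ (β ≠ 0 ∨ i = m) := by
  have hroot : ∀ β ∈ Ω, S r β = 0 := fun β hβ => by
    rw [hΩ]; exact Finset.prod_eq_zero hβ (sub_self β)
  induction m with
  | zero =>
    obtain ⟨β, hβ, h1⟩ := exists_root_sub_lt v hΩ h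
    exact ⟨0, le_rfl, β, hβ, ⟨by simp, h1, hroot β hβ⟩, Or.inr rfl⟩
  | succ m ih =>
    obtain ⟨i, him, β, hβ, ht, h1⟩ := ih
    by_cases hβ0 : β = 0
    · subst hβ0
      obtain rfl := h1.resolve_left (by simp)
      have h2 : v (ξ i) < 1 := by simpa using ht.sub_lt
      have h3 : v (S r (ξ (i + 1))) < 1 := by
        rw [hξ.v_S_succ_of_lt v hr h2, v_S_of_lt v hr h2]
        exact pow_lt_one₀ zero_le h2 (by omega)
      obtain ⟨β, hβ, h4⟩ := exists_root_sub_lt v hΩ h3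
      refine ⟨i + 1, le_rfl, β, hβ, ⟨fun l hl => ?_, h4, hroot β hβ⟩, Or.inr rfl⟩
      rcases (Nat.lt_succ_iff_lt_or_eq.1 hl) with h5 | rfl
      · exact ht.lt l h5
      · exact h2
    · exact ⟨i, by omega, β, hβ, ht, Or.inl hβ0⟩

theorem HasType.v_eq_one (h : HasType v r ξ i β) (hr : 2 ≤ r) (hβ : β ≠ 0) : v (ξ i) = 1 := by
  have h1 := v_root_eq_one v hr h.root hβ
  have := v.map_add_eq_of_lt_right (x := ξ i - β) (y := β) (by rw [h1]; exact h.sub_lt)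
  rwa [sub_add_cancel, h1] at this

theorem HasType.v_succ_pow (h : HasType v r ξ i β) (hξ : IsPoint r ξ) (hr : 2 ≤ r)
    (hadd : ∀ a b : L, (a + b) ^ r = a ^ r + b ^ r) (hβ : β ≠ 0) :
    v (ξ (i + 1)) ^ r = (v (S r (ξ i)))⁻¹ ∧ 1 < v (ξ (i + 1)) := by
  have h0 := v.ne_zero_iff.2 (hξ.S_ne (by omega) i)
  have h1 := hξ.v_rel v i
  rw [h.v_eq_one hr hβ, one_pow] at h1
  have h2 : v (S r (ξ (i + 1))) = (v (S r (ξ i)))⁻¹ := eq_inv_of_mul_eq_one_left h1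
  have h3 : 1 < v (S r (ξ (i + 1))) := by
    rw [h2, one_lt_inv₀ (zero_lt_iff.2 h0), h.v_S hr hadd]; exact h.sub_lt
  rw [v_pow_of_S_gt v hr h3]
  exact ⟨h2, one_lt_of_one_lt_pow (n := r) (by rw [v_pow_of_S_gt v hr h3]; exact h3)⟩

theorem HasType.v_gt (h : HasType v r ξ i β) (hξ : IsPoint r ξ) (hr : 2 ≤ r)
    (hadd : ∀ a b : L, (a + b) ^ r = a ^ r + b ^ r) (hβ : β ≠ 0) (k : ℕ) :
    1 < v (ξ (i + 1 + k)) := by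
  induction k with
  | zero => exact (h.v_succ_pow hξ hr hadd hβ).2
  | succ k ih => exact hξ.v_gt_of_gt v hr ih

theorem HasType.v_add_pow (h : HasType v r ξ i β) (hξ : IsPoint r ξ) (hr : 2 ≤ r)
    (hadd : ∀ a b : L, (a + b) ^ r = a ^ r + b ^ r) (hβ : β ≠ 0) (k : ℕ) :
    v (ξ (i + 1 + k)) ^ r ^ (k + 1) = (v (S r (ξ 0)))⁻¹ ^ r ^ i := by
  induction k with
  | zero =>
    rw [zero_add, pow_one, add_zero, (h.v_succ_pow hξ hr hadd hβ).1, h.v_S_pow hξ hr le_rfl,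
      inv_pow]
  | succ k ih =>
    rw [pow_succ' r (k + 1), pow_mul, ← add_assoc,
      hξ.v_succ_of_gt v hr (h.v_gt hξ hr hadd hβ k), ih]

theorem HasType.pyramid (h : HasType v r ξ i β) (hξ : IsPoint r ξ) (hr : 3 ≤ r)
    (hadd : ∀ a b : L, (a + b) ^ r = a ^ r + b ^ r) (hβ : β ≠ 0)
    (hc : (β ^ (r + 1)) ^ r = β ^ (r + 1)) {k : ℕ} (hk : k + 1 ≤ i) :
    v (ξ (i + (k + 1)) - β ^ (r + 1) * (1 / ξ (i - (k + 1)))) ≤ 1 := by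
  have hr1 : 1 ≤ r := by omega
  have hr2 : 2 ≤ r := by omega
  have hSi : ∀ l, v (S r (ξ l)) ≠ 0 := fun l => v.ne_zero_iff.2 (hξ.S_ne hr1 l)
  have hcv : v (β ^ (r + 1)) = 1 := by rw [map_pow, v_root_eq_one v hr2 h.root hβ, one_pow]
  induction k with
  | zero =>
    apply v_le_of_S_le v hr2
    rw [S_sub hadd, S_mul_of_pow_eq hc, hξ.S_inv hr1, hξ.S_succ hr1, zero_add,
      Nat.sub_add_cancel hk, mul_one_div, ← sub_div, map_div₀]
    apply div_le_one_of_le₀ _ zero_le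
    rw [h.v_S hr2 hadd]
    set δ := ξ i - β with hδ
    have e : ξ i ^ (r + 1) - β ^ (r + 1) = δ * (β ^ r + δ ^ (r - 1) * (β + δ)) := by
      have : ξ i = β + δ := by rw [hδ]; ring
      rw [this, pow_succ, hadd]
      obtain ⟨t, rfl⟩ := Nat.exists_eq_add_of_le' hr1
      rw [Nat.add_sub_cancel]; ring
    have hδ1 : v δ ≤ 1 := h.sub_lt.le
    have hβ1 := h.v_beta_le hr2
    rw [e, map_mul]
    refine mul_le_of_le_one_right' (v.map_add_le ?_ ?_)
    · rw [map_pow]; exact pow_le_one₀ zero_le hβ1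
    · rw [map_mul, map_pow]
      exact mul_le_one' (pow_le_one₀ zero_le hδ1) (v.map_add_le hβ1 hδ1)
  | succ k ih =>
    have ih := ih (by omega)
    apply v_le_of_S_le v hr2
    have e1 : i + (k + 1 + 1) = i + (k + 1) + 1 := by ring
    have e2 : i - (k + 1 + 1) + 1 = i - (k + 1) := by omega
    rw [S_sub hadd, S_mul_of_pow_eq hc, hξ.S_inv hr1, e1, hξ.S_succ hr1, e2]
    set y := ξ (i + (k + 1)) with hy
    set ζ := ξ (i - (k + 1)) with hζ
    have hy1 : 1 < v y := by
      have := h.v_gt hξ hr2 hadd hβ k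
      rwa [add_assoc, add_comm 1 k] at this
    have hζ1 : v ζ < 1 := h.lt _ (by omega)
    have hζ0 : ζ ≠ 0 := hξ.ne_zero hr1 _
    have hy0 : y ≠ 0 := hξ.ne_zero hr1 _
    have hSζ : S r ζ ≠ 0 := hξ.S_ne hr1 _
    have hSy : S r y ≠ 0 := hξ.S_ne hr1 _
    have e3 : y ^ (r + 1) / S r y - β ^ (r + 1) * (1 / S r ζ)
        = (y - β ^ (r + 1) * (1 / ζ)) + (β ^ (r + 1) * (ζ ^ r / (ζ * S r ζ)) - y ^ 2 / S r y) := by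
      have a1 : y ^ (r + 1) / S r y = y - y ^ 2 / S r y := by
        rw [eq_sub_iff_add_eq, ← add_div, div_eq_iff hSy, S]; ring
      have a2 : 1 / S r ζ = 1 / ζ - ζ ^ r / (ζ * S r ζ) := by
        rw [eq_sub_iff_add_eq]
        field_simp
        rw [S]; ring
      rw [a1, a2]; ring
    rw [e3]
    refine v.map_add_le ih (v.map_sub_le ?_ ?_)
    · rw [map_mul, hcv, one_mul, map_div₀]
      apply div_le_one_of_le₀ _ zero_le
      rw [map_mul, v_S_of_lt v hr2 hζ1, ← pow_two, map_pow]
      exact pow_le_pow_right_of_le_one' hζ1.le hr2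
    · rw [map_div₀]
      apply div_le_one_of_le₀ _ zero_le
      rw [v_S_of_gt v hr2 hy1, map_pow]
      exact pow_le_pow_right₀ hy1.le hr2

end Valuation

section Local

variable {L : Type*} [Field L] {r : ℕ} {ξ : ℕ → L}

/-- The coordinate `ξ (l + 1)`, corrected by its polar part at points of type `(i, β)`. -/
def shift (r i : ℕ) (β : L) (ξ : ℕ → L) (l : ℕ) : L :=
  if i < l + 1 ∧ l + 1 ≤ 2 * i then ξ (l + 1) - β ^ (r + 1) * (1 / ξ (2 * i - (l + 1)))
  else ξ (l + 1)

/-- The trace-dual of the monomial `z ^ j`. -/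
def dual (r j : ℕ) (z : L) : L := z ^ (r - 1 - j) + if j = 0 then 1 else 0

/-- A function which is a unit at points of type `(i, β)` and vanishes at those of other types. -/
def sep (r i : ℕ) (β : L) (ξ : ℕ → L) : L :=
  ((ξ i - β) ^ (r - 1) + 1) * ∏ l ∈ Finset.range i, (ξ l ^ (r - 1) + 1)

/-- A multiple of a shifted dual monomial with bounded poles. -/
def testFun (r m N i : ℕ) (β : L) (j : Fin m → Fin r) (ξ : ℕ → L) : L :=
  sep r i β ξ ^ N * ∏ l : Fin m, dual r (j l) (shift r i β ξ l)

variable {Γ : Type*} [LinearOrderedCommGroupWithZero Γ] {v : Valuation L Γ}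
variable {i m : ℕ} {β : L}

theorem HasType.v_shift_le (h : HasType v r ξ i β) (hξ : IsPoint r ξ) (hr : 3 ≤ r)
    (hadd : ∀ a b : L, (a + b) ^ r = a ^ r + b ^ r) (hβ : β ≠ 0 ∨ i = m)
    (hc : (β ^ (r + 1)) ^ r = β ^ (r + 1)) {l : ℕ} (hlm : l < m) (hl : l + 1 ≤ 2 * i) :
    v (shift r i β ξ l) ≤ 1 := by
  rw [shift]
  split_ifs with h1
  · have hβ0 : β ≠ 0 := hβ.resolve_right (by omega)
    have := h.pyramid hξ hr hadd hβ0 hc (k := l - i) (by omega)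
    rwa [show i + (l - i + 1) = l + 1 by omega,
      show i - (l - i + 1) = 2 * i - (l + 1) by omega] at this
  · have h2 : l + 1 ≤ i := by omega
    rcases h2.lt_or_eq with h3 | h3
    · exact (h.lt _ h3).le
    · rw [h3]
      have := v.map_add_le h.sub_lt.le (h.v_beta_le (by omega))
      rwa [sub_add_cancel] at this

theorem shift_of_lt {l : ℕ} (hl : 2 * i < l + 1) : shift r i β ξ l = ξ (l + 1) := by
  rw [shift, if_neg (by omega)]

theorem HasType.prod_le (h : HasType v r ξ i β) (hξ : IsPoint r ξ) (hr : 3 ≤ r)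
    (hadd : ∀ a b : L, (a + b) ^ r = a ^ r + b ^ r) (hβ : β ≠ 0 ∨ i = m)
    (hc : (β ^ (r + 1)) ^ r = β ^ (r + 1)) {G : ℕ → Γ}
    (hG : ∀ l < m, G l ≤ max 1 (v (shift r i β ξ l)) ^ (r - 1)) :
    ∏ l ∈ Finset.range m, G l ≤ (v (S r (ξ 0)))⁻¹ := by
  have hr2 : 2 ≤ r := by omega
  have hb := h.v_S_zero_lt hξ hr2 hadd
  have hb0 : 0 < v (S r (ξ 0)) := zero_lt_iff.2 (v.ne_zero_iff.2 hξ.ne)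
  have hb1 : 1 ≤ (v (S r (ξ 0)))⁻¹ := (one_le_inv₀ hb0).2 hb.le
  have hsmall : ∀ n ≤ m, n ≤ 2 * i → ∏ l ∈ Finset.range n, G l ≤ 1 := by
    intro n hn hni
    refine Finset.prod_le_one' fun l hl => ?_
    have hl' := Finset.mem_range.1 hl
    refine (hG l (by omega)).trans ?_
    rw [max_eq_left (h.v_shift_le hξ hr hadd hβ hc (by omega) (by omega)), one_pow]
  by_cases hm : m ≤ 2 * i
  · exact (hsmall m le_rfl hm).trans hb1
  have hβ0 : β ≠ 0 := hβ.resolve_right (by omega)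
  have hgt : ∀ k, 1 < v (ξ (2 * i + 1 + k)) := fun k => by
    have := h.v_gt hξ hr2 hadd hβ0 (i + k)
    rwa [show i + 1 + (i + k) = 2 * i + 1 + k by ring] at this
  have hGk : ∀ k, 2 * i + k < m → G (2 * i + k) * v (ξ (2 * i + 1 + k)) ≤
      v (ξ (2 * i + 1 + k)) ^ r := by
    intro k hk
    have := hG (2 * i + k) hk
    rw [shift_of_lt (by omega), show 2 * i + k + 1 = 2 * i + 1 + k by ring,
      max_eq_right (hgt k).le] at this
    calc _ ≤ v (ξ (2 * i + 1 + k)) ^ (r - 1) * v (ξ (2 * i + 1 + k)) :=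
          mul_le_mul_left this _
      _ = _ := by rw [← pow_succ, Nat.sub_add_cancel (by omega)]
  have hfirst : v (ξ (2 * i + 1)) ^ r = (v (S r (ξ 0)))⁻¹ := by
    have := h.v_add_pow hξ hr2 hadd hβ0 i
    rw [show i + 1 + i = 2 * i + 1 by ring, pow_succ' r i, pow_mul] at this
    exact (pow_left_inj₀ zero_le zero_le (by positivity)).1 this
  have main : ∀ k, 2 * i + k < m →
      (∏ l ∈ Finset.range (2 * i + k + 1), G l) * v (ξ (2 * i + 1 + k)) ≤
        (v (S r (ξ 0)))⁻¹ := by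
    intro k
    induction k with
    | zero =>
      intro hk
      rw [Finset.prod_range_succ, mul_assoc, ← hfirst]
      exact (mul_le_mul' (hsmall _ (by omega) (by omega)) (hGk 0 hk)).trans (by simp)
    | succ k ih =>
      intro hk
      rw [Finset.prod_range_succ, mul_assoc]
      refine (mul_le_mul_right (hGk (k + 1) hk) _).trans ?_
      rw [← add_assoc (2 * i + 1) k 1, hξ.v_succ_of_gt v hr2 (hgt k)]
      exact ih (by omega)
  obtain ⟨k, hk⟩ : ∃ k, m = 2 * i + k + 1 := ⟨m - 2 * i - 1, by omega⟩
  refine le_trans ?_ (main k (by omega))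
  rw [hk]
  exact le_mul_of_one_le_right' (hgt k).le

theorem v_dual_le (z : L) (j : ℕ) : v (dual r j z) ≤ max 1 (v z) ^ (r - 1) := by
  have h1 : 1 ≤ max 1 (v z) := le_max_left _ _
  refine v.map_add_le ?_ ?_
  · rw [map_pow]
    exact (pow_le_pow_left' (le_max_right 1 _) _).trans (pow_le_pow_right₀ h1 (by omega))
  · split_ifs
    · rw [map_one]; exact one_le_pow₀ h1
    · rw [map_zero]; exact zero_le

theorem HasType.v_prod_shift_mul_le (h : HasType v r ξ i β) (hξ : IsPoint r ξ) (hr : 3 ≤ r)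
    (hadd : ∀ a b : L, (a + b) ^ r = a ^ r + b ^ r) (hβ : β ≠ 0 ∨ i = m)
    (hc : (β ^ (r + 1)) ^ r = β ^ (r + 1)) (j : Fin m → Fin r) :
    v (∏ l : Fin m, shift r i β ξ l ^ (j l : ℕ)) ≤ (v (S r (ξ 0)))⁻¹ := by
  have := h.prod_le hξ hr hadd hβ hc
    (G := fun l => if hl : l < m then v (shift r i β ξ l ^ (j ⟨l, hl⟩ : ℕ)) else 1) (by
      intro l hl
      rw [dif_pos hl, map_pow]
      exact (pow_le_pow_left' (le_max_right 1 _) _).trans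
        (pow_le_pow_right₀ (le_max_left _ _) (by have := (j ⟨l, hl⟩).2; omega)))
  rw [Finset.prod_range] at this
  rw [map_prod]
  simpa using this

theorem HasType.v_prod_dual_le (h : HasType v r ξ i β) (hξ : IsPoint r ξ) (hr : 3 ≤ r)
    (hadd : ∀ a b : L, (a + b) ^ r = a ^ r + b ^ r) (hβ : β ≠ 0 ∨ i = m)
    (hc : (β ^ (r + 1)) ^ r = β ^ (r + 1)) (j : Fin m → Fin r) :
    v (∏ l : Fin m, dual r (j l) (shift r i β ξ l)) ≤ (v (S r (ξ 0)))⁻¹ := by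
  have := h.prod_le hξ hr hadd hβ hc
    (G := fun l => if hl : l < m then v (dual r (j ⟨l, hl⟩) (shift r i β ξ l)) else 1) (by
      intro l hl
      rw [dif_pos hl]
      exact v_dual_le _ _)
  rw [Finset.prod_range] at this
  rw [map_prod]
  simpa using this

theorem v_pow_add_one_of_lt (hr : 2 ≤ r) {z : L} (h : v z < 1) : v (z ^ (r - 1) + 1) = 1 := by
  rw [add_comm, v.map_one_add_of_lt]
  rw [map_pow]; exact pow_lt_one₀ zero_le h (by omega)

theorem HasType.v_sep (h : HasType v r ξ i β) (hr : 2 ≤ r) : v (sep r i β ξ) = 1 := by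
  rw [sep, map_mul, map_prod, v_pow_add_one_of_lt hr h.sub_lt, one_mul]
  exact Finset.prod_eq_one fun l hl => v_pow_add_one_of_lt hr (h.lt l (Finset.mem_range.1 hl))

theorem v_pow_add_one_le (z : L) : v (z ^ (r - 1) + 1) ≤ max 1 (v z) ^ (r - 1) := by
  refine v.map_add_le ?_ ?_
  · rw [map_pow]; exact pow_le_pow_left' (le_max_right 1 _) _
  · rw [map_one]; exact one_le_pow₀ (le_max_left _ _)

theorem v_pow_add_one_eq (hr : 1 ≤ r) {z : L} (h : v z = 1) :
    v (z ^ (r - 1) + 1) = v (S r z) := by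
  rw [S_eq_mul hr, map_mul, h, one_mul]

/-- The separating functions are small at points of another type. -/
theorem HasType.v_sep_pow_le (h : HasType v r ξ i β) (hξ : IsPoint r ξ) (hr : 3 ≤ r)
    (hadd : ∀ a b : L, (a + b) ^ r = a ^ r + b ^ r) (hβ : β ≠ 0 ∨ i = m) (him : i ≤ m)
    {i' : ℕ} {β' : L} (hβ'0 : β' ≠ 0 ∨ i' = m) (hi'm : i' ≤ m) (hβ' : S r β' = 0)
    (hββ' : β ≠ β' → v (β - β') = 1)
    (hne : ¬ (i = i' ∧ β = β')) : v (sep r i' β' ξ) ^ r ^ m ≤ v (S r (ξ 0)) := by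
  have hr2 : 2 ≤ r := by omega
  have hb := h.v_S_zero_lt hξ hr2 hadd
  have hb0 : 0 < v (S r (ξ 0)) := zero_lt_iff.2 (v.ne_zero_iff.2 hξ.ne)
  have hpos : ∀ k, r ^ k ≠ 0 := fun k => by positivity
  have key : v ((ξ i' - β') ^ (r - 1) + 1) = v (S r (ξ i')) → i' ≤ i →
      v (sep r i' β' ξ) ^ r ^ m ≤ v (S r (ξ 0)) := by
    intro e hle
    have h1 : v (sep r i' β' ξ) = v (S r (ξ i')) := by
      rw [sep, map_mul, map_prod, e, Finset.prod_eq_one, mul_one]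
      exact fun l hl => v_pow_add_one_of_lt hr2
        (h.lt l (by have := Finset.mem_range.1 hl; exact this.trans_le hle))
    rw [h1, h.v_S_pow hξ hr2 hle, ← pow_mul]
    calc _ ≤ v (S r (ξ 0)) ^ 1 :=
          pow_le_pow_right_of_le_one' hb.le
            (Nat.one_le_iff_ne_zero.2 (mul_ne_zero (hpos _) (hpos _)))
      _ = _ := pow_one _
  rcases lt_trichotomy i i' with hlt | rfl | hlt
  · -- the type of the point comes before `i'`
    have hβ0 : β ≠ 0 := hβ.resolve_right (by omega)
    obtain ⟨k, rfl⟩ : ∃ k, i' = i + 1 + k := ⟨i' - i - 1, by omega⟩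
    have hgt := h.v_gt hξ hr2 hadd hβ0
    have hlast : v ((ξ (i + 1 + k) - β') ^ (r - 1) + 1) ≤ v (ξ (i + 1 + k)) ^ (r - 1) := by
      have e : v (ξ (i + 1 + k) - β') = v (ξ (i + 1 + k)) :=
        v.map_sub_eq_of_lt_left ((v_le_of_S_le v hr2 (by rw [hβ', map_zero]; exact zero_le)).trans_lt
          (hgt k))
      refine (v_pow_add_one_le _).trans ?_
      rw [e, max_eq_right (hgt k).le]
    have main : ∀ k, (∏ l ∈ Finset.range (i + 1 + k), v (ξ l ^ (r - 1) + 1)) *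
        v (ξ (i + 1 + k)) ^ r ≤ 1 := by
      intro k
      induction k with
      | zero =>
        rw [add_zero, Finset.prod_range_succ, Finset.prod_eq_one fun l hl =>
          v_pow_add_one_of_lt hr2 (h.lt l (Finset.mem_range.1 hl)), one_mul,
          v_pow_add_one_eq (by omega) (h.v_eq_one hr2 hβ0), (h.v_succ_pow hξ hr2 hadd hβ0).1,
          mul_inv_cancel₀ (v.ne_zero_iff.2 (hξ.S_ne (by omega) i))]
      | succ k ih =>
        rw [← add_assoc, Finset.prod_range_succ, hξ.v_succ_of_gt v hr2 (hgt k), mul_assoc]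
        refine (mul_le_mul_right ?_ _).trans ih
        calc _ ≤ v (ξ (i + 1 + k)) ^ (r - 1) * v (ξ (i + 1 + k)) := by
              refine mul_le_mul_left ((v_pow_add_one_le _).trans ?_) _
              rw [max_eq_right (hgt k).le]
          _ = _ := by rw [← pow_succ, Nat.sub_add_cancel (by omega)]
    have h1 : v (sep r (i + 1 + k) β' ξ) * v (ξ (i + 1 + k)) ≤ 1 := by
      rw [sep, map_mul, map_prod]
      refine le_trans ?_ (main k)
      rw [mul_comm (v _) (∏ l ∈ _, _), mul_assoc]
      refine mul_le_mul_right ?_ _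
      calc _ ≤ v (ξ (i + 1 + k)) ^ (r - 1) * v (ξ (i + 1 + k)) := mul_le_mul_left hlast _
        _ = _ := by rw [← pow_succ, Nat.sub_add_cancel (by omega)]
    have h2 : v (sep r (i + 1 + k) β' ξ) ≤ (v (ξ (i + 1 + k)))⁻¹ :=
      (le_mul_inv_iff₀ (zero_lt_one.trans (hgt k))).2 h1 |>.trans (by simp)
    have h3 : (v (ξ (i + 1 + k)))⁻¹ ≤ 1 := inv_le_one_of_one_le₀ (hgt k).le
    calc _ ≤ (v (ξ (i + 1 + k)))⁻¹ ^ r ^ m := pow_le_pow_left' h2 _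
      _ ≤ (v (ξ (i + 1 + k)))⁻¹ ^ r ^ (k + 1) :=
        pow_le_pow_right_of_le_one' h3 (Nat.pow_le_pow_right (by omega) (by omega))
      _ = v (S r (ξ 0)) ^ r ^ i := by
        rw [inv_pow, h.v_add_pow hξ hr2 hadd hβ0, inv_pow, inv_inv]
      _ ≤ v (S r (ξ 0)) ^ 1 :=
        pow_le_pow_right_of_le_one' hb.le (Nat.one_le_iff_ne_zero.2 (hpos i))
      _ = _ := pow_one _
  · have hne' : β ≠ β' := fun e => hne ⟨rfl, e⟩
    refine key ?_ le_rfl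
    rw [v_pow_add_one_eq (by omega), S_sub hadd, hβ', sub_zero]
    rw [← sub_add_sub_cancel _ β, v.map_add_eq_of_lt_right, hββ' hne']
    rw [hββ' hne']; exact h.sub_lt
  · have hβ'1 := v_root_eq_one v hr2 hβ' (hβ'0.resolve_right (by omega))
    refine key ?_ hlt.le
    rw [v_pow_add_one_eq (by omega), S_sub hadd, hβ', sub_zero]
    rw [v.map_sub_eq_of_lt_right, hβ'1]
    rw [hβ'1]; exact h.lt _ hlt

theorem HasType.v_mul_pow_le (h : HasType v r ξ i β) (hξ : IsPoint r ξ) (hr : 2 ≤ r)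
    (hadd : ∀ a b : L, (a + b) ^ r = a ^ r + b ^ r) (hβ : β ≠ 0 ∨ i = m) (him : i ≤ m) {l : ℕ}
    (hl : l ≤ m) :
    v (ξ l) * v (S r (ξ 0)) ^ r ^ m ≤ 1 ∧ (v (ξ l))⁻¹ * v (S r (ξ 0)) ^ r ^ m ≤ 1 := by
  have hb := h.v_S_zero_lt hξ hr hadd
  have hb0 : 0 < v (S r (ξ 0)) := zero_lt_iff.2 (v.ne_zero_iff.2 hξ.ne)
  have h0 : 0 < v (ξ l) := zero_lt_iff.2 (v.ne_zero_iff.2 (hξ.ne_zero (by omega) l))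
  have hp : v (S r (ξ 0)) ^ r ^ m ≤ 1 := pow_le_one₀ zero_le hb.le
  have hpow : ∀ k ≤ m, v (S r (ξ 0)) ^ r ^ m ≤ v (S r (ξ 0)) ^ r ^ k := fun k hk =>
    pow_le_pow_right_of_le_one' hb.le (Nat.pow_le_pow_right (by omega) hk)
  have hsmall : l ≤ i → v (ξ l) < 1 → v (ξ l) * v (S r (ξ 0)) ^ r ^ m ≤ 1 ∧
      (v (ξ l))⁻¹ * v (S r (ξ 0)) ^ r ^ m ≤ 1 := by
    intro hli hlt
    refine ⟨mul_le_one' hlt.le hp, ?_⟩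
    rw [inv_mul_le_iff₀ h0, mul_one, ← v_S_of_lt v hr hlt, h.v_S_pow hξ hr hli]
    exact hpow l hl
  rcases lt_trichotomy l i with h1 | rfl | h1
  · exact hsmall h1.le (h.lt l h1)
  · by_cases hβ0 : β = 0
    · subst hβ0
      exact hsmall le_rfl (by simpa using h.sub_lt)
    · simpa [h.v_eq_one hr hβ0] using hp
  · have hβ0 : β ≠ 0 := hβ.resolve_right (by omega)
    obtain ⟨k, rfl⟩ : ∃ k, l = i + 1 + k := ⟨l - i - 1, by omega⟩
    have hgt := h.v_gt hξ hr hadd hβ0 k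
    refine ⟨?_, mul_le_one' (inv_le_one_of_one_le₀ hgt.le) hp⟩
    rw [← le_mul_inv_iff₀ (pow_pos hb0 _), one_mul]
    calc v (ξ (i + 1 + k)) ≤ v (ξ (i + 1 + k)) ^ r ^ (k + 1) :=
          le_self_pow₀ hgt.le (by positivity)
      _ = (v (S r (ξ 0)))⁻¹ ^ r ^ i := h.v_add_pow hξ hr hadd hβ0 k
      _ ≤ (v (S r (ξ 0)) ^ r ^ m)⁻¹ := by
        rw [← inv_pow]
        exact pow_le_pow_right₀ ((one_le_inv₀ hb0).2 hb.le)
          (Nat.pow_le_pow_right (by omega) him)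

end Local

/-- The arithmetic of a field `L` of characteristic dividing `r`, with `Ω` the set of roots of
`z ^ r + z`, which is all that the tower depends on. -/
structure Setup (L : Type*) [Field L] (r : ℕ) (Ω : Finset L) : Prop where
  le : 3 ≤ r
  cast : (r : L) = 0
  add_pow : ∀ a b : L, (a + b) ^ r = a ^ r + b ^ r
  prod : ∀ z : L, S r z = ∏ ω ∈ Ω, (z - ω)
  card : Ω.card = r
  pow_eq : ∀ β ∈ Ω, (β ^ (r + 1)) ^ r = β ^ (r + 1)

namespace Setup

variable {L : Type*} [Field L] {r : ℕ} {Ω : Finset L} {ξ : ℕ → L}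
variable {Γ : Type*} [LinearOrderedCommGroupWithZero Γ] {v : Valuation L Γ}
variable {i m : ℕ} {β : L}

theorem S_eq_zero (s : Setup L r Ω) {β : L} (hβ : β ∈ Ω) : S r β = 0 := by
  rw [s.prod]; exact Finset.prod_eq_zero hβ (sub_self β)

theorem mem_iff (s : Setup L r Ω) {β : L} : β ∈ Ω ↔ S r β = 0 := by
  refine ⟨s.S_eq_zero, fun h => ?_⟩
  rw [s.prod, Finset.prod_eq_zero_iff] at h
  obtain ⟨ω, hω, h1⟩ := h
  rwa [sub_eq_zero.1 h1]

theorem two_le (s : Setup L r Ω) : 2 ≤ r := by have := s.le; omega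

theorem one_le (s : Setup L r Ω) : 1 ≤ r := by have := s.le; omega

/-- The exponent of `sep` in the test functions. -/
abbrev sepExp (r m : ℕ) : ℕ := r ^ m * (r ^ m * (r - 1) * m)

theorem v_mul_testFun_le (s : Setup L r Ω) (hξ : IsPoint r ξ) (h0 : v (ξ 0) ≤ 1)
    (hβΩ : β ∈ Ω) (hβ : β ≠ 0 ∨ i = m) (him : i ≤ m) (j : Fin m → Fin r) :
    v (S r (ξ 0)) * v (testFun r m (sepExp r m) i β j ξ) ≤ 1 := by
  have hb1 : v (S r (ξ 0)) ≤ 1 := v_S_le v h0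
  have hb0 : 0 < v (S r (ξ 0)) := zero_lt_iff.2 (v.ne_zero_iff.2 hξ.ne)
  have hβ1 : v β ≤ 1 := v_le_of_S_le v s.two_le (by simp [s.S_eq_zero hβΩ])
  have hc1 : v (β ^ (r + 1)) ≤ 1 := by rw [map_pow]; exact pow_le_one₀ zero_le hβ1
  rw [testFun, map_mul, map_pow]
  rcases hb1.lt_or_eq with hlt | heq
  · obtain ⟨i', hi'm, β', hβ'Ω, ht, hβ'⟩ := exists_hasType v s.prod hξ s.two_le hlt m
    by_cases hty : i' = i ∧ β' = β
    · obtain ⟨rfl, rfl⟩ := hty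
      rw [ht.v_sep s.two_le, one_pow, one_mul]
      refine (mul_le_mul_right (ht.v_prod_dual_le hξ s.le s.add_pow hβ (s.pow_eq _ hβΩ) j) _).trans ?_
      rw [mul_inv_cancel₀ hb0.ne']
    · have hsep := ht.v_sep_pow_le hξ s.le s.add_pow hβ' hi'm hβ him (s.S_eq_zero hβΩ)
        (fun hne => v_root_eq_one v s.two_le
          (by rw [S_sub s.add_pow, s.S_eq_zero hβΩ, s.S_eq_zero hβ'Ω, sub_zero])
          (sub_ne_zero.2 hne)) hty
      have hcr : ∀ l ≤ m, _ := fun l hl => ht.v_mul_pow_le hξ s.two_le s.add_pow hβ' hi'm hl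
      set B := v (S r (ξ 0)) ^ r ^ m with hB
      have hB1 : B ≤ 1 := pow_le_one₀ zero_le hb1
      have hB0 : 0 < B := pow_pos hb0 _
      have hshift : ∀ l < m, v (shift r i β ξ l) ≤ B⁻¹ := by
        intro l hl
        have h1 : v (ξ (l + 1)) ≤ B⁻¹ := by
          have := (hcr (l + 1) (by omega)).1
          rwa [← le_mul_inv_iff₀ hB0, one_mul] at this
        rw [shift]
        split_ifs with hc
        · refine v.map_sub_le h1 ?_
          have := (hcr (2 * i - (l + 1)) (by omega)).2
          rw [← le_mul_inv_iff₀ hB0, one_mul] at this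
          rw [map_mul, map_div₀, map_one, one_div]
          exact (mul_le_mul' hc1 this).trans (by rw [one_mul])
        · exact h1
      have hdual : ∀ l : Fin m, v (dual r (j l) (shift r i β ξ l)) ≤ B⁻¹ ^ (r - 1) := by
        intro l
        refine (v_dual_le _ _).trans (pow_le_pow_left' ?_ _)
        exact max_le ((one_le_inv₀ hB0).2 hB1) (hshift l l.2)
      have hprod : v (∏ l : Fin m, dual r (j l) (shift r i β ξ l)) ≤ (B⁻¹ ^ (r - 1)) ^ m := by
        rw [map_prod]
        refine (Finset.prod_le_prod' fun l _ => hdual l).trans ?_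
        simp
      refine mul_le_one' hb1 ?_
      have e : (B⁻¹ ^ (r - 1)) ^ m = (v (S r (ξ 0)) ^ (r ^ m * (r - 1) * m))⁻¹ := by
        rw [hB, inv_pow, inv_pow, ← pow_mul, ← pow_mul, mul_assoc]
      rw [sepExp, pow_mul]
      refine (mul_le_mul' (pow_le_pow_left' hsep _) hprod).trans ?_
      rw [e, mul_inv_cancel₀ (pow_ne_zero _ hb0.ne')]
  · have h1 := hξ.v_eq_one v s.two_le h0 heq
    rw [heq, one_mul]
    refine mul_le_one' (pow_le_one₀ zero_le ?_) ?_
    · rw [sep, map_mul, map_prod]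
      refine mul_le_one' ?_ (Finset.prod_le_one' fun l _ => ?_)
      · refine (v_pow_add_one_le _).trans (pow_le_one₀ zero_le (max_le le_rfl ?_))
        exact v.map_sub_le (h1 i).le hβ1
      · refine (v_pow_add_one_le _).trans (pow_le_one₀ zero_le (max_le le_rfl (h1 l).le))
    · rw [map_prod]
      refine Finset.prod_le_one' fun l _ => (v_dual_le _ _).trans
        (pow_le_one₀ zero_le (max_le le_rfl ?_))
      rw [shift]
      split_ifs
      · refine v.map_sub_le (h1 _).le ?_
        rw [map_mul, map_div₀, h1, map_one, div_one, mul_one]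
        exact hc1
      · exact (h1 _).le

theorem exists_sep (s : Setup L r Ω) (hξ : IsPoint r ξ) (h : v (S r (ξ 0)) < 1) (m : ℕ) :
    ∃ i ≤ m, ∃ β ∈ Ω, (β ≠ 0 ∨ i = m) ∧ v (sep r i β ξ) = 1 ∧
      ∀ j : Fin m → Fin r, v (∏ l : Fin m, shift r i β ξ l ^ (j l : ℕ)) ≤ (v (S r (ξ 0)))⁻¹ := by
  obtain ⟨i, him, β, hβΩ, ht, hβ⟩ := exists_hasType v s.prod hξ s.two_le h m
  exact ⟨i, him, β, hβΩ, hβ, ht.v_sep s.two_le,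
    ht.v_prod_shift_mul_le hξ s.le s.add_pow hβ (s.pow_eq _ hβΩ)⟩

theorem v_mul_pow_le (s : Setup L r Ω) (hξ : IsPoint r ξ) (h0 : v (ξ 0) ≤ 1) {l m : ℕ}
    (hl : l ≤ m) : v (ξ l) * v (S r (ξ 0)) ^ r ^ m ≤ 1 := by
  rcases (v_S_le v h0 (r := r)).lt_or_eq with hlt | heq
  · obtain ⟨i, him, β, hβΩ, ht, hβ⟩ := exists_hasType v s.prod hξ s.two_le hlt m
    exact (ht.v_mul_pow_le hξ s.two_le s.add_pow hβ him hl).1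
  · rw [heq, one_pow, mul_one, hξ.v_eq_one v s.two_le h0 heq]

/-- The monomial `∏ ξ (l + 1) ^ j l`. -/
def mon {m : ℕ} (j : Fin m → Fin r) (ξ : ℕ → L) : L := ∏ l : Fin m, ξ (l + 1) ^ (j l : ℕ)

theorem v_mon_mul_pow_le (s : Setup L r Ω) (hξ : IsPoint r ξ) (h0 : v (ξ 0) ≤ 1)
    (j : Fin m → Fin r) : v (mon j ξ) * v (S r (ξ 0)) ^ sepExp r m ≤ 1 := by
  have hb1 : v (S r (ξ 0)) ≤ 1 := v_S_le v h0
  have key : v (mon j ξ) * v (S r (ξ 0)) ^ (r ^ m * (r - 1) * m) ≤ 1 := by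
    have : v (S r (ξ 0)) ^ (r ^ m * (r - 1) * m) =
        ∏ _l : Fin m, (v (S r (ξ 0)) ^ r ^ m) ^ (r - 1) := by
      simp [pow_mul]
    rw [this, mon, map_prod, ← Finset.prod_mul_distrib]
    refine Finset.prod_le_one' fun l _ => ?_
    rw [map_pow]
    have hle : (v (S r (ξ 0)) ^ r ^ m) ^ (r - 1) ≤ (v (S r (ξ 0)) ^ r ^ m) ^ (j l : ℕ) :=
      pow_le_pow_right_of_le_one' (pow_le_one₀ zero_le hb1) (by have := (j l).2; omega)
    refine (mul_le_mul_right hle _).trans ?_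
    rw [← mul_pow]
    exact pow_le_one₀ zero_le (s.v_mul_pow_le hξ h0 (by omega))
  refine le_trans (mul_le_mul_right ?_ _) key
  exact pow_le_pow_right_of_le_one' hb1
    (Nat.le_mul_of_pos_left _ (pow_pos (by have := s.le; omega) _))

end Setup

open Polynomial

section Points

variable {L : Type*} [Field L] {r : ℕ} {Ω : Finset L}

/-- A chosen solution of `S z = c`. -/
noncomputable def rootS [IsAlgClosed L] (r : ℕ) (c : L) : L :=
  open Classical in if h : ∃ z, S r z = c then h.choose else 0

theorem S_rootS [IsAlgClosed L] (hr : 2 ≤ r) (c : L) : S r (rootS r c) = c := by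
  have h : ∃ z, S r z = c := by
    obtain ⟨z, hz⟩ := IsAlgClosed.exists_root (X ^ r + X - C c : L[X]) (by
      have h1 : (X ^ r + (X - C c) : L[X]).degree = r := by
        rw [degree_add_eq_left_of_degree_lt] <;> rw [degree_X_pow]
        rw [degree_X_sub_C]; exact_mod_cast hr
      rw [add_sub_assoc, h1]
      exact_mod_cast (by omega : r ≠ 0))
    exact ⟨z, by simpa [sub_eq_zero, S] using hz⟩
  rw [rootS, dif_pos h]
  exact h.choose_spec

/-- The points above `a`, parametrized by sequences of roots of `S`. -/
noncomputable def pt [IsAlgClosed L] (r : ℕ) (h : ℕ → L) (a : L) : ℕ → L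
  | 0 => a
  | l + 1 => rootS r (pt r h a l ^ (r + 1) / S r (pt r h a l)) + h l

theorem pt_zero [IsAlgClosed L] (h : ℕ → L) (a : L) : pt r h a 0 = a := rfl

/-- Extension of a tuple by zero. -/
def ext {m : ℕ} (h : Fin m → Ω) (l : ℕ) : L := if hl : l < m then (h ⟨l, hl⟩ : L) else 0

namespace Setup

variable {m : ℕ}

theorem S_ext (s : Setup L r Ω) (h : Fin m → Ω) (l : ℕ) : S r (ext h l) = 0 := by
  rw [ext]
  split_ifs with hl
  · exact s.S_eq_zero (h ⟨l, hl⟩).2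
  · exact S_zero s.one_le

variable [IsAlgClosed L]

theorem S_pt_succ (s : Setup L r Ω) {h : ℕ → L} (hh : ∀ l, S r (h l) = 0) (a : L) (l : ℕ) :
    S r (pt r h a (l + 1)) = pt r h a l ^ (r + 1) / S r (pt r h a l) := by
  rw [pt, S_add s.add_pow, hh, add_zero, S_rootS s.two_le]

theorem isPoint_pt (s : Setup L r Ω) {h : ℕ → L} (hh : ∀ l, S r (h l) = 0) {a : L}
    (ha : S r a ≠ 0) : IsPoint r (pt r h a) := by
  have hne : ∀ l, S r (pt r h a l) ≠ 0 := by
    intro l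
    induction l with
    | zero => exact ha
    | succ l ih =>
      rw [s.S_pt_succ hh]
      exact div_ne_zero (pow_ne_zero _ (IsPoint.ne_zero_of_S s.one_le ih)) ih
  exact ⟨ha, fun l => by rw [s.S_pt_succ hh, div_mul_cancel₀ _ (hne l)]⟩

theorem isPoint (s : Setup L r Ω) (h : Fin m → Ω) {a : L} (ha : S r a ≠ 0) :
    IsPoint r (pt r (ext h) a) :=
  s.isPoint_pt (s.S_ext h) ha

omit [IsAlgClosed L] in
theorem sum_dual (s : Setup L r Ω) (x y : L) :
    ∑ j : Fin r, dual r j y * x ^ (j : ℕ) = (x - y) ^ (r - 1) + 1 := by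
  have hr := s.one_le
  have hsub : (x - y) ^ r = x ^ r - y ^ r := by
    have := s.add_pow (x - y) y
    rw [sub_add_cancel] at this
    rw [this]; ring
  have h1 : ∑ j : Fin r, (if (j : ℕ) = 0 then (1 : L) else 0) * x ^ (j : ℕ) = 1 := by
    rw [Finset.sum_eq_single ⟨0, hr⟩]
    · simp
    · intro b _ hb
      rw [if_neg (fun h => hb (Fin.ext h)), zero_mul]
    · simp
  have h2 : ∑ j : Fin r, y ^ (r - 1 - (j : ℕ)) * x ^ (j : ℕ) = (x - y) ^ (r - 1) := by
    by_cases hxy : x = y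
    · subst hxy
      rw [sub_self, zero_pow (by have := s.le; omega)]
      have : ∀ j : Fin r, x ^ (r - 1 - (j : ℕ)) * x ^ (j : ℕ) = x ^ (r - 1) := fun j => by
        rw [← pow_add]; congr 1; have := j.2; omega
      simp [this, s.cast]
    · have h3 := (Commute.all x y).geom_sum₂_mul r
      rw [← hsub] at h3
      apply mul_right_cancel₀ (sub_ne_zero.2 hxy)
      rw [← pow_succ, Nat.sub_add_cancel hr, ← h3, Finset.sum_range]
      congr 1
      exact Finset.sum_congr rfl fun j _ => mul_comm _ _
  simp only [dual, add_mul, Finset.sum_add_distrib, h1, h2]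

omit [IsAlgClosed L] in
theorem shift_sub_shift {ξ ξ' : ℕ → L} {i l : ℕ} {β : L} (h : ∀ k ≤ l, ξ k = ξ' k) :
    shift r i β ξ l - shift r i β ξ' l = ξ (l + 1) - ξ' (l + 1) := by
  rw [shift, shift]
  split_ifs with h1
  · rw [h (2 * i - (l + 1)) (by omega)]; ring
  · rfl

theorem prod_sum_dual (s : Setup L r Ω) (i : ℕ) (β a : L) (h h' : Fin m → Ω) [Decidable (h = h')] :
    ∏ l : Fin m, ∑ j : Fin r, dual r j (shift r i β (pt r (ext h') a) l) *
      shift r i β (pt r (ext h) a) l ^ (j : ℕ) = if h = h' then 1 else 0 := by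
  simp_rw [s.sum_dual]
  split_ifs with heq
  · subst heq
    refine Finset.prod_eq_one fun l _ => ?_
    rw [sub_self, zero_pow (by have := s.le; omega), zero_add]
  · obtain ⟨l, hl, hmin⟩ : ∃ l : ℕ, ext h l ≠ ext h' l ∧ ∀ k < l, ext h k = ext h' k := by
      have : ∃ l, ext h l ≠ ext h' l := by
        by_contra! hall
        refine heq (funext fun l => Subtype.ext ?_)
        simpa [ext] using hall l
      classical
      exact ⟨Nat.find this, Nat.find_spec this, fun k hk => not_not.1 (Nat.find_min this hk)⟩
    have hlm : l < m := by
      by_contra hlm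
      exact hl (by simp [ext, hlm])
    have hagree : ∀ k ≤ l, pt r (ext h) a k = pt r (ext h') a k := by
      intro k
      induction k with
      | zero => intro _; rfl
      | succ k ih => intro hk; rw [pt, pt, ih (by omega), hmin k (by omega)]
    refine Finset.prod_eq_zero (Finset.mem_univ ⟨l, hlm⟩) ?_
    rw [shift_sub_shift hagree, pt, pt, hagree l le_rfl, add_sub_add_left_eq_sub]
    have h0 : S r (ext h l - ext h' l) = 0 := by
      rw [S_sub s.add_pow, s.S_ext, s.S_ext, sub_zero]
    rw [S_eq_mul s.one_le, mul_eq_zero] at h0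
    exact h0.resolve_left (sub_ne_zero.2 hl)

/-- Every function on the points above `a` is recovered from its traces against the (shifted) dual
monomials. -/
theorem reproducing (s : Setup L r Ω) (i : ℕ) (β a : L) (f : (Fin m → Ω) → L) (h : Fin m → Ω) :
    ∑ j : Fin m → Fin r,
      (∑ h' : Fin m → Ω, f h' * ∏ l : Fin m, dual r (j l) (shift r i β (pt r (ext h') a) l)) *
        ∏ l : Fin m, shift r i β (pt r (ext h) a) l ^ (j l : ℕ) = f h := by
  classical
  simp_rw [Finset.sum_mul, mul_assoc, ← Finset.prod_mul_distrib]
  rw [Finset.sum_comm]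
  simp_rw [← Finset.mul_sum]
  have key : ∀ h' : Fin m → Ω, ∑ j : Fin m → Fin r,
      ∏ l : Fin m, (dual r (j l) (shift r i β (pt r (ext h') a) l) *
        shift r i β (pt r (ext h) a) l ^ (j l : ℕ)) = if h = h' then 1 else 0 := fun h' => by
    rw [← s.prod_sum_dual i β a h h', Fintype.prod_sum]
  simp [key]

/-- The power sums of the translates of `Ω`. -/
def powSum (R : Type*) [CommRing R] (r k : ℕ) : R :=
  if k = r - 1 then 1 else if k = 2 * r - 2 then -1 else 0

theorem prod_erase (s : Setup L r Ω) [DecidableEq L] {ω : L} (hω : ω ∈ Ω) :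
    ∏ j ∈ Ω.erase ω, (ω - j) = 1 := by
  have hn : Lagrange.nodal Ω id = (X ^ r + X : L[X]) := by
    refine Polynomial.funext fun z => ?_
    rw [Lagrange.eval_nodal]
    simpa [S] using (s.prod z).symm
  have h1 := Lagrange.eval_nodal_derivative_eval_node_eq (v := (id : L → L)) hω
  rw [hn, Lagrange.eval_nodal] at h1
  simp only [id] at h1
  rw [← h1]
  simp [derivative_X_pow, s.cast]

theorem sum_pow_of_lt (s : Setup L r Ω) (c : L) {k : ℕ} (hk : k < r) :
    ∑ ω ∈ Ω, (c + ω) ^ k = if k = r - 1 then 1 else 0 := by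
  classical
  have := Lagrange.coeff_eq_sum (s := Ω) (v := fun ω => c + ω) (P := (X : L[X]) ^ k)
    (fun a _ b _ hab => add_left_cancel hab) (by rw [degree_X_pow, s.card]; exact_mod_cast hk)
  rw [s.card, coeff_X_pow] at this
  simp only [eq_comm (a := k)]
  rw [this]
  refine Finset.sum_congr rfl fun ω hω => ?_
  simp only [add_sub_add_left_eq_sub]
  rw [s.prod_erase hω]
  simp

theorem sum_pow (s : Setup L r Ω) (c : L) {k : ℕ} (hk : k ≤ 2 * r - 2) :
    ∑ ω ∈ Ω, (c + ω) ^ k = powSum L r k := by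
  have hr := s.le
  by_cases hkr : k < r
  · rw [s.sum_pow_of_lt c hkr, powSum]
    split_ifs <;> first | rfl | omega
  · obtain ⟨t, rfl⟩ : ∃ t, k = t + r := ⟨k - r, by omega⟩
    have h1 : ∀ ω ∈ Ω, (c + ω) ^ (t + r) = S r c * (c + ω) ^ t - (c + ω) ^ (t + 1) := by
      intro ω hω
      have : S r (c + ω) = S r c := by rw [S_add s.add_pow, s.S_eq_zero hω, add_zero]
      rw [← this, S]; ring
    rw [Finset.sum_congr rfl h1, Finset.sum_sub_distrib, ← Finset.mul_sum,
      s.sum_pow_of_lt c (by omega), s.sum_pow_of_lt c (by omega), powSum, if_neg (by omega),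
      mul_zero, zero_sub, if_neg (by omega : ¬ t + r = r - 1)]
    by_cases ht : t + 1 = r - 1
    · rw [if_pos ht, if_pos (by omega)]
    · rw [if_neg ht, if_neg (by omega), neg_zero]

theorem pt_succ_eq (h : ℕ → L) (a : L) (l : ℕ) :
    pt r h a (l + 1) = pt r (fun k => h (k + 1)) (pt r h a 1) l := by
  induction l with
  | zero => rfl
  | succ l ih => rw [pt, ih]; rfl

theorem sum_prod_pow (s : Setup L r Ω) (k : Fin m → ℕ) (hk : ∀ l, k l ≤ 2 * r - 2) (a : L) :
    ∑ h : Fin m → Ω, ∏ l : Fin m, pt r (ext h) a (l + 1) ^ k l = ∏ l, powSum L r (k l) := by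
  induction m generalizing a with
  | zero => simp
  | succ m ih =>
    rw [← (Fin.consEquiv (fun _ => Ω)).sum_comp, Fintype.sum_prod_type]
    simp_rw [Fin.prod_univ_succ]
    have e0 : ∀ (ω : Ω) (h : Fin m → Ω), pt r (ext (Fin.cons ω h : Fin (m + 1) → Ω)) a 1 =
        rootS r (a ^ (r + 1) / S r a) + ω := fun ω h => by simp [pt, ext]
    have e1 : ∀ (ω : Ω) (h : Fin m → Ω) (l : ℕ),
        pt r (ext (Fin.cons ω h : Fin (m + 1) → Ω)) a (l + 1) =
          pt r (ext h) (rootS r (a ^ (r + 1) / S r a) + ω) l := fun ω h l => by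
      rw [pt_succ_eq, e0]
      congr 1
      funext k
      simp only [ext]
      by_cases hkm : k < m
      · rw [dif_pos hkm, dif_pos (by omega)]; rfl
      · rw [dif_neg hkm, dif_neg (by omega)]
    simp only [Fin.consEquiv, Equiv.coe_fn_mk, e1, Fin.val_zero, Fin.val_succ, pt_zero, ← Finset.mul_sum]
    simp_rw [ih (fun l => k l.succ) (fun l => hk _)]
    rw [← Finset.sum_mul, ← s.sum_pow _ (hk 0)]
    congr 1
    exact Finset.sum_coe_sort Ω (fun ω => (rootS r (a ^ (r + 1) / S r a) + ω) ^ k 0)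

end Setup

end Points

section Reduction

variable (F : Type*) {L : Type*} [Field F] [Field L] [Algebra F L] {r : ℕ}

variable (L r) in
/-- The points of the tower over `L`. -/
abbrev Point : Type _ := {ξ : ℕ → L // IsPoint r ξ}

/-- The coordinate functions on points. -/
def coord (l : ℕ) : Point L r → L := fun ξ => ξ.1 l

/-- The algebra of functions generated by the coordinates up to level `m` and their inverses. -/
noncomputable def level (L : Type*) [Field L] [Algebra F L] (r : ℕ) :
    ℕ → Subalgebra F (Point L r → L)
  | 0 => Algebra.adjoin F {coord 0, fun ξ => (S r (ξ.1 0))⁻¹}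
  | m + 1 => (Algebra.adjoin (level L r m) {coord (m + 1)}).restrictScalars F

variable {F}

theorem level_le_succ (m : ℕ) : level F L r m ≤ level F L r (m + 1) := fun f hf =>
  (Algebra.adjoin (level F L r m) {coord (m + 1)}).algebraMap_mem ⟨f, hf⟩

theorem level_mono {l m : ℕ} (h : l ≤ m) : level F L r l ≤ level F L r m :=
  monotone_nat_of_le_succ (level_le_succ (F := F) (L := L) (r := r)) h

theorem coord_mem (m : ℕ) : coord m ∈ level F L r m := by
  cases m with
  | zero => exact Algebra.subset_adjoin (by simp)
  | succ m => exact Algebra.subset_adjoin (R := level F L r m) (by simp)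

theorem inv_coord_eq (hr : 1 ≤ r) (m : ℕ) :
    (fun ξ : Point L r => (ξ.1 m)⁻¹) = (coord m ^ (r - 1) + 1) * fun ξ => (S r (ξ.1 m))⁻¹ := by
  funext ξ
  have h0 := ξ.2.ne_zero hr m
  have h1 := ξ.2.S_ne hr m
  simp only [Pi.mul_apply, Pi.add_apply, Pi.pow_apply, Pi.one_apply, coord]
  rw [eq_mul_inv_iff_mul_eq₀ h1, S_eq_mul hr, inv_mul_cancel_left₀ h0]

theorem inv_S_mem (hr : 1 ≤ r) (m : ℕ) :
    (fun ξ : Point L r => (S r (ξ.1 m))⁻¹) ∈ level F L r m := by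
  induction m with
  | zero => exact Algebra.subset_adjoin (by simp)
  | succ m ih =>
    have hc := coord_mem (F := F) (L := L) (r := r) m
    have hi : (fun ξ : Point L r => (ξ.1 m)⁻¹) ∈ level F L r m := by
      rw [inv_coord_eq hr]
      exact mul_mem (add_mem (pow_mem hc _) (one_mem _)) ih
    have e : (fun ξ : Point L r => (S r (ξ.1 (m + 1)))⁻¹) =
        (coord m ^ r + coord m) * (fun ξ : Point L r => (ξ.1 m)⁻¹) ^ (r + 1) := by
      funext ξ
      simp only [Pi.mul_apply, Pi.add_apply, Pi.pow_apply, coord]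
      rw [ξ.2.S_succ hr, inv_div, inv_pow, div_eq_mul_inv, S]
    rw [e]
    exact level_le_succ m (mul_mem (add_mem (pow_mem hc _) hc) (pow_mem hi _))

theorem inv_coord_mem (hr : 1 ≤ r) (m : ℕ) :
    (fun ξ : Point L r => (ξ.1 m)⁻¹) ∈ level F L r m := by
  rw [inv_coord_eq hr]
  exact mul_mem (add_mem (pow_mem (coord_mem m) _) (one_mem _)) (inv_S_mem hr m)

open scoped Classical in
theorem exists_sum_pow (hr : 2 ≤ r) {m : ℕ} {f : Point L r → L} (hf : f ∈ level F L r (m + 1)) :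
    ∃ g : Fin r → Point L r → L, (∀ k, g k ∈ level F L r m) ∧
      ∀ ξ, f ξ = ∑ k, g k ξ * ξ.1 (m + 1) ^ (k : ℕ) := by
  have hu : (coord m ^ (r + 1) * fun ξ : Point L r => (S r (ξ.1 m))⁻¹) ∈ level F L r m :=
    mul_mem (pow_mem (coord_mem m) _) (inv_S_mem (by omega) m)
  set u : level F L r m := ⟨_, hu⟩ with hu_def
  set P : (level F L r m)[X] := X ^ r + (X + C (-u)) with hP
  have hsub : Subsingleton (level F L r m) ∨ Nontrivial (level F L r m) :=
    subsingleton_or_nontrivial _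
  rcases hsub with hsub | hnt
  · have h01 : (1 : Point L r → L) = 0 :=
      congrArg Subtype.val (Subsingleton.elim (1 : level F L r m) 0)
    exact ⟨fun _ => 0, fun _ => zero_mem _, fun ξ =>
      absurd (congrFun h01 ξ) (by simp)⟩
  have hdeg : (X + C (-u)).degree < (r : WithBot ℕ) := by
    rw [degree_X_add_C]; exact_mod_cast hr
  have hmonic : P.Monic := monic_X_pow_add hdeg
  have hnat : P.natDegree = r := by
    refine natDegree_eq_of_degree_eq_some ?_
    rw [hP, degree_add_eq_left_of_degree_lt (by rwa [degree_X_pow]), degree_X_pow]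
  have hroot : aeval (coord (m + 1) : Point L r → L) P = 0 := by
    have hC : aeval (coord (m + 1) : Point L r → L) (C (-u)) = ((-u : level F L r m) : Point L r → L) :=
      aeval_C _ _
    rw [hP, map_add, map_add, map_pow, aeval_X, hC]
    funext ξ
    have h1 := ξ.2.S_succ (r := r) (by omega) m
    change (ξ.1 (m + 1)) ^ r + (ξ.1 (m + 1) + -(ξ.1 m ^ (r + 1) * (S r (ξ.1 m))⁻¹)) = 0
    rw [← div_eq_mul_inv, ← h1, S]; ring
  have hspan := Submodule.span_range_natDegree_eq_adjoin hmonic hroot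
  have hf' : f ∈ Subalgebra.toSubmodule (Algebra.adjoin (level F L r m) {coord (m + 1)}) := hf
  rw [← hspan, hnat, Finset.coe_image, Submodule.mem_span_image_finset_iff_exists_fun'] at hf'
  obtain ⟨c, hc⟩ := hf'
  refine ⟨fun k => c k, fun k => (c k).2, fun ξ => ?_⟩
  rw [← hc, Finset.sum_range, Finset.sum_apply]
  rfl

theorem level_zero_form {f : Point L r → L} (hf : f ∈ level F L r 0) :
    ∃ k, ∃ p : F[X], ∀ ξ : Point L r, S r (ξ.1 0) ^ k * f ξ = aeval (ξ.1 0) p := by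
  have hS : ∀ ξ : Point L r, S r (ξ.1 0) = aeval (ξ.1 0) (X ^ r + X : F[X]) := fun ξ => by
    simp [S]
  refine Algebra.adjoin_induction (hx := hf) ?_ ?_ ?_ ?_
  · rintro f (rfl | rfl)
    · exact ⟨0, X, fun ξ => by simp [coord]⟩
    · exact ⟨1, 1, fun ξ => by simp [ξ.2.ne]⟩
  · exact fun a => ⟨0, C a, fun ξ => by simp⟩
  · rintro f g - - ⟨k, p, hp⟩ ⟨k', p', hp'⟩
    refine ⟨k + k', p * (X ^ r + X) ^ k' + p' * (X ^ r + X) ^ k, fun ξ => ?_⟩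
    rw [map_add, map_mul, map_mul, map_pow, map_pow, ← hS, ← hp, ← hp', Pi.add_apply]
    ring
  · rintro f g - - ⟨k, p, hp⟩ ⟨k', p', hp'⟩
    refine ⟨k + k', p * p', fun ξ => ?_⟩
    rw [map_mul, ← hp, ← hp', Pi.mul_apply]
    ring

theorem level_zero_common {ι : Type*} [Fintype ι] {f : ι → Point L r → L}
    (hf : ∀ i, f i ∈ level F L r 0) :
    ∃ k, ∃ p : ι → F[X], ∀ i, ∀ ξ : Point L r, S r (ξ.1 0) ^ k * f i ξ = aeval (ξ.1 0) (p i) := by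
  choose k p hp using fun i => level_zero_form (hf i)
  have hk : ∀ i, k i ≤ ∑ j, k j := fun i => Finset.single_le_sum (fun _ _ => zero_le) (Finset.mem_univ i)
  refine ⟨∑ i, k i, fun i => (X ^ r + X) ^ (∑ j, k j - k i) * p i, fun i ξ => ?_⟩
  rw [map_mul, ← hp, ← mul_assoc]
  simp only [map_pow, map_add, aeval_X]
  rw [← S, ← pow_add, Nat.sub_add_cancel (hk i)]

/-- Functions of level `m` are combinations of monomials with rational coefficients. -/
theorem exists_expansion (hr : 2 ≤ r) (m : ℕ) {f : Point L r → L} (hf : f ∈ level F L r m) :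
    ∃ c : (Fin m → Fin r) → Point L r → L, (∀ j, c j ∈ level F L r 0) ∧
      ∀ ξ, f ξ = ∑ j, c j ξ * Setup.mon j ξ.1 := by
  induction m generalizing f with
  | zero =>
    exact ⟨fun _ => f, fun _ => hf, fun ξ => by simp [Setup.mon]⟩
  | succ m ih =>
    obtain ⟨g, hg, hfg⟩ := exists_sum_pow hr hf
    choose c hc hgc using fun k => ih (hg k)
    refine ⟨fun j => c (j (Fin.last m)) (Fin.init j), fun j => hc _ _, fun ξ => ?_⟩
    rw [hfg, ← (Fin.snocEquiv (fun _ => Fin r)).sum_comp, Fintype.sum_prod_type]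
    refine Finset.sum_congr rfl fun k _ => ?_
    rw [hgc, Finset.sum_mul]
    refine Finset.sum_congr rfl fun j _ => ?_
    simp only [Fin.snocEquiv, Equiv.coe_fn_mk, Fin.snoc_last, Fin.init_snoc, Setup.mon,
      Fin.prod_univ_castSucc, Fin.snoc_castSucc, Fin.val_castSucc, Fin.val_last, mul_assoc]

theorem exists_polynomial_expansion (hr : 2 ≤ r) {ι : Type*} [Fintype ι] (m : ℕ)
    {f : ι → Point L r → L} (hf : ∀ i, f i ∈ level F L r m) :
    ∃ k, ∃ p : ι → (Fin m → Fin r) → F[X], ∀ i, ∀ ξ : Point L r,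
      S r (ξ.1 0) ^ k * f i ξ = ∑ j, aeval (ξ.1 0) (p i j) * Setup.mon j ξ.1 := by
  choose c hc hfc using fun i => exists_expansion hr m (hf i)
  obtain ⟨k, p, hp⟩ := level_zero_common (ι := ι × (Fin m → Fin r)) (f := fun x => c x.1 x.2)
    (fun x => hc _ _)
  refine ⟨k, fun i j => p (i, j), fun i ξ => ?_⟩
  rw [hfc, Finset.mul_sum]
  exact Finset.sum_congr rfl fun j _ => by rw [← hp (i, j), mul_assoc]

end Reduction

open Module

section LinearAlgebra

variable {F : Type*} [Field F] {V : Type*} [AddCommGroup V] [Module F V] [FiniteDimensional F V]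

theorem finrank_le_add_finrank_orthogonal (B : LinearMap.BilinForm F V) (M : Submodule F V) :
    finrank F V ≤ finrank F M + finrank F (B.orthogonal M) := by
  have := LinearMap.BilinForm.finrank_add_finrank_orthogonal' (B := B) M
  omega

theorem finrank_add_le_finrank_inf (M P : Submodule F V) :
    finrank F M + finrank F P ≤ finrank F (M ⊓ P : Submodule F V) + finrank F V := by
  have h1 := Submodule.finrank_sup_add_finrank_inf_eq M P
  have h2 := (M ⊔ P).finrank_le
  omega

end LinearAlgebra

section Pairing

variable {F J : Type*} [Field F] [Fintype J]

variable (J) in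
/-- Vectors of polynomials of degree less than `k`. -/
noncomputable def degV (F : Type*) [Field F] (k : ℕ) : Submodule F (J → F[X]) :=
  Submodule.pi Set.univ fun _ => degreeLT F k

omit [Fintype J] in
theorem mem_degV {k : ℕ} {p : J → F[X]} : p ∈ degV J F k ↔ ∀ j, (p j).degree < k := by
  simp [degV, Submodule.mem_pi, mem_degreeLT]

/-- The space of vectors of polynomials of bounded degree in coordinates. -/
noncomputable def degVEquiv (k : ℕ) : degV J F k ≃ₗ[F] (J → Fin k → F) where
  toFun p j := degreeLTEquiv F k ⟨p.1 j, p.2 j (Set.mem_univ _)⟩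
  map_add' p q := by
    funext j
    exact (degreeLTEquiv F k).map_add ⟨p.1 j, p.2 j (Set.mem_univ _)⟩ ⟨q.1 j, q.2 j (Set.mem_univ _)⟩
  map_smul' c p := by
    funext j
    exact (degreeLTEquiv F k).map_smul c ⟨p.1 j, p.2 j (Set.mem_univ _)⟩
  invFun f := ⟨fun j => (degreeLTEquiv F k).symm (f j), fun j _ => Subtype.property _⟩
  left_inv p := by
    ext1
    funext j
    simp
  right_inv f := by
    funext j
    simp

instance (k : ℕ) : FiniteDimensional F (degV J F k) :=
  Module.Finite.equiv (degVEquiv (F := F) (J := J) k).symm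

theorem finrank_degV (k : ℕ) : finrank F (degV J F k) = Fintype.card J * k := by
  rw [(degVEquiv (F := F) (J := J) k).finrank_eq, Module.finrank_pi_fintype]
  simp

omit [Fintype J] in
theorem degV_mono {k k' : ℕ} (h : k ≤ k') : degV J F k ≤ degV J F k' := fun p hp =>
  mem_degV.2 fun j => (mem_degV.1 hp j).trans_le (by exact_mod_cast h)

/-- The symmetric pairing of polynomial vectors with Gram matrix `G`. -/
noncomputable def pairing (G : J → J → F) (p q : J → F[X]) : F[X] :=
  ∑ i, ∑ j, C (G i j) * (p i * q j)

variable {G : J → J → F}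

theorem pairing_add_left (p p' q : J → F[X]) :
    pairing G (p + p') q = pairing G p q + pairing G p' q := by
  simp only [pairing, Pi.add_apply, add_mul, mul_add, Finset.sum_add_distrib]

theorem pairing_add_right (p q q' : J → F[X]) :
    pairing G p (q + q') = pairing G p q + pairing G p q' := by
  simp only [pairing, Pi.add_apply, mul_add, Finset.sum_add_distrib]

theorem pairing_smul_left (f : F[X]) (p q : J → F[X]) :
    pairing G (f • p) q = f * pairing G p q := by
  simp only [pairing, Pi.smul_apply, smul_eq_mul, Finset.mul_sum]
  exact Finset.sum_congr rfl fun i _ => Finset.sum_congr rfl fun j _ => by ring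

theorem pairing_smul_right (f : F[X]) (p q : J → F[X]) :
    pairing G p (f • q) = f * pairing G p q := by
  simp only [pairing, Pi.smul_apply, smul_eq_mul, Finset.mul_sum]
  exact Finset.sum_congr rfl fun i _ => Finset.sum_congr rfl fun j _ => by ring

theorem dvd_pairing {E : F[X]} {p : J → F[X]} (h : ∀ j, E ∣ p j) (q : J → F[X]) :
    E ∣ pairing G p q :=
  Finset.dvd_sum fun i _ => Finset.dvd_sum fun _ _ => ((h i).mul_right _).mul_left _

theorem degree_pairing_lt {k k' : ℕ} {p q : J → F[X]} (hp : p ∈ degV J F (k + 1))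
    (hq : q ∈ degV J F k') : (pairing G p q).degree < ((k + k' : ℕ) : WithBot ℕ) := by
  rw [← mem_degreeLT]
  refine Submodule.sum_mem _ fun i _ => Submodule.sum_mem _ fun j _ => ?_
  rw [← smul_eq_C_mul]
  refine Submodule.smul_mem _ _ (mem_degreeLT.2 ?_)
  have h1 := mem_degV.1 hp i
  have h2 := mem_degV.1 hq j
  by_cases h0 : p i * q j = 0
  · rw [h0, degree_zero]; exact WithBot.bot_lt_coe _
  · have hp0 := left_ne_zero_of_mul h0
    have hq0 := right_ne_zero_of_mul h0
    rw [degree_eq_natDegree hp0] at h1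
    rw [degree_eq_natDegree hq0] at h2
    rw [degree_eq_natDegree h0, natDegree_mul hp0 hq0]
    norm_cast at h1 h2 ⊢
    omega

/-- The top coefficient of the pairing modulo `E`, as a bilinear form. -/
noncomputable def residueForm (G : J → J → F) (E : F[X]) :
    LinearMap.BilinForm F (J → F[X]) :=
  LinearMap.mk₂ F (fun p q => (pairing G p q %ₘ E).coeff (E.natDegree - 1))
    (fun p p' q => by rw [pairing_add_left, add_modByMonic, coeff_add])
    (fun c p q => by
      have : c • p = C c • p := by ext1 j; simp [smul_eq_C_mul]
      rw [this, pairing_smul_left, ← smul_eq_C_mul, smul_modByMonic, coeff_smul])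
    (fun p q q' => by rw [pairing_add_right, add_modByMonic, coeff_add])
    (fun c p q => by
      have : c • q = C c • q := by ext1 j; simp [smul_eq_C_mul]
      rw [this, pairing_smul_right, ← smul_eq_C_mul, smul_modByMonic, coeff_smul])

/-- Polynomials orthogonal to a module under the residue form pair into multiples of `E`. -/
theorem dvd_pairing_of_residueForm {E : F[X]} (hE : E.Monic) (Mt : Submodule F[X] (J → F[X]))
    (hEM : ∀ p : J → F[X], (∀ j, E ∣ p j) → p ∈ Mt) {q : J → F[X]}
    (hq : ∀ p ∈ Mt, p ∈ degV J F E.natDegree → residueForm G E p q = 0) {p : J → F[X]}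
    (hp : p ∈ Mt) : E ∣ pairing G p q := by
  by_contra hdvd
  set R := pairing G p q %ₘ E with hR
  have hR0 : R ≠ 0 := fun h => hdvd ((modByMonic_eq_zero_iff_dvd hE).1 h)
  have hRdeg : R.degree < E.degree := degree_modByMonic_lt _ hE
  have hRn : R.natDegree < E.natDegree := natDegree_lt_natDegree hR0 hRdeg
  set t := E.natDegree - 1 - R.natDegree with ht
  set p' : J → F[X] := fun j => (X ^ t * p j) %ₘ E with hp'
  have hsub : p' - (X ^ t : F[X]) • p ∈ Mt := hEM _ fun j => by
    simpa [hp'] using dvd_modByMonic_sub (X ^ t * p j) E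
  have hp'M : p' ∈ Mt := by
    have := Mt.add_mem hsub (Mt.smul_mem (X ^ t : F[X]) hp)
    rwa [sub_add_cancel] at this
  have hp'V : p' ∈ degV J F E.natDegree := mem_degV.2 fun j => by
    rw [← degree_eq_natDegree hE.ne_zero]
    exact degree_modByMonic_lt _ hE
  have h0 := hq p' hp'M hp'V
  have hd : E ∣ pairing G p' q - X ^ t * R := by
    have h1 : pairing G p' q - X ^ t * R =
        pairing G (p' - (X ^ t : F[X]) • p) q + X ^ t * (pairing G p q - R) := by
      have := pairing_add_left (G := G) (p' - (X ^ t : F[X]) • p) ((X ^ t : F[X]) • p) q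
      rw [sub_add_cancel, pairing_smul_left] at this
      rw [this]; ring
    rw [h1]
    refine dvd_add (dvd_pairing (fun j => ?_) _) (Dvd.dvd.mul_left ?_ _)
    · simpa [hp'] using dvd_modByMonic_sub (X ^ t * p j) E
    · rw [← neg_sub, dvd_neg]; exact dvd_modByMonic_sub _ _
  have hmod : pairing G p' q %ₘ E = X ^ t * R := by
    rw [modByMonic_eq_of_dvd_sub hE hd, modByMonic_eq_self_iff hE]
    refine degree_lt_degree ?_
    rw [natDegree_X_pow_mul t hR0]; omega
  change (pairing G p' q %ₘ E).coeff (E.natDegree - 1) = 0 at h0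
  rw [hmod, show E.natDegree - 1 = R.natDegree + t by omega, coeff_X_pow_mul] at h0
  exact hR0 (leadingCoeff_eq_zero.1 h0)

end Pairing

section Code

variable {F J : Type*} [Field F] [Fintype J]

/-- Evaluation of polynomial vectors at the points of the fibres over `A`. -/
noncomputable def evalMap (A : Finset F) (U : F → J → J → F) :
    (J → F[X]) →ₗ[F] (A × J → F) where
  toFun p x := ∑ j, (p j).eval (x.1 : F) * U x.1 j x.2
  map_add' p q := by
    funext x
    simp only [Pi.add_apply, eval_add, add_mul, Finset.sum_add_distrib]
  map_smul' c p := by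
    funext x
    simp only [Pi.smul_apply, eval_smul, smul_eq_mul, Finset.mul_sum, mul_assoc, RingHom.id_apply]

variable {A : Finset F} {U : F → J → J → F} {G : J → J → F}

theorem sum_evalMap_mul {a : A} (hU : ∀ i j, ∑ h, U a i h * U a j h = G i j)
    (p q : J → F[X]) :
    ∑ h, evalMap A U p (a, h) * evalMap A U q (a, h) = (pairing G p q).eval (a : F) := by
  simp only [evalMap, LinearMap.coe_mk, AddHom.coe_mk, pairing, eval_finsetSum, eval_mul, eval_C,
    Finset.sum_mul_sum]
  rw [Finset.sum_comm]
  refine Finset.sum_congr rfl fun i _ => ?_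
  rw [Finset.sum_comm]
  refine Finset.sum_congr rfl fun j _ => ?_
  rw [← hU i j, Finset.sum_mul]
  exact Finset.sum_congr rfl fun h _ => by ring

/-- The diagonal bilinear form with given weights. -/
noncomputable def weightForm {ι : Type*} [Fintype ι] (w : ι → F) :
    LinearMap.BilinForm F (ι → F) :=
  LinearMap.mk₂ F (fun x y => ∑ i, w i * x i * y i)
    (fun x x' y => by simp only [Pi.add_apply, mul_add, add_mul, Finset.sum_add_distrib])
    (fun c x y => by
      simp only [Pi.smul_apply, smul_eq_mul, Finset.mul_sum]
      exact Finset.sum_congr rfl fun i _ => by ring)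
    (fun x y y' => by simp only [Pi.add_apply, mul_add, Finset.sum_add_distrib])
    (fun c x y => by
      simp only [Pi.smul_apply, smul_eq_mul, Finset.mul_sum]
      exact Finset.sum_congr rfl fun i _ => by ring)

theorem weightForm_apply {ι : Type*} [Fintype ι] (w : ι → F) (x y : ι → F) :
    weightForm w x y = ∑ i, w i * x i * y i := rfl

theorem finrank_add_finrank_weightForm_orthogonal {ι : Type*} [Fintype ι] {w : ι → F}
    (hw : ∀ i, w i ≠ 0) (C : Submodule F (ι → F)) :
    finrank F C + finrank F ((weightForm w).orthogonal C) = Fintype.card ι := by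
  classical
  have hker : LinearMap.ker (weightForm w) = ⊥ := by
    rw [LinearMap.ker_eq_bot']
    intro x hx
    funext i
    have h := LinearMap.congr_fun hx (Pi.single i 1)
    rw [weightForm_apply, Finset.sum_eq_single i (fun j _ hj => by simp [hj]) (by simp)] at h
    simpa [hw i] using h
  have := LinearMap.BilinForm.finrank_add_finrank_orthogonal' (B := weightForm w) C
  rw [hker, inf_bot_eq, finrank_bot, add_zero, Module.finrank_pi] at this
  exact this

theorem exists_code {E : F[X]} (hE : E.Monic) (Mt : Submodule F[X] (J → F[X]))
    (hEM : ∀ p : J → F[X], (∀ j, E ∣ p j) → p ∈ Mt)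
    (hself : ∀ q, (∀ p ∈ Mt, E ∣ pairing G p q) → q ∈ Mt)
    {e : ℕ} (hdeg : E.natDegree = 2 * e) (hAE : ∀ a ∈ A, E.eval a ≠ 0)
    (hU : ∀ a ∈ A, ∀ i j, ∑ h, U a i h * U a j h = G i j)
    {κ κ' Z : ℕ} (hκ : κ' ≤ κ) (hκe : κ ≤ e) (hA : κ + κ' = A.card)
    (hZ : Z < A.card * Fintype.card J)
    (hzero : ∀ p ∈ Mt, p ≠ 0 → p ∈ degV J F (κ + e) →
      {x | evalMap A U p x = 0}.ncard ≤ Z) :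
    ∃ w : A × J → F, (∀ i, w i ≠ 0) ∧ ∃ C : Submodule F (A × J → F),
      (∀ x, (∀ y ∈ C, ∑ i, w i * x i * y i = 0) → x ∈ C) ∧
      Fintype.card J * κ ≤ finrank F C ∧
      ∀ x ∈ C, x ≠ 0 → A.card * Fintype.card J ≤ Z + {i | x i ≠ 0}.ncard := by
  classical
  set d := Fintype.card J with hd
  set D := E.natDegree with hD
  -- the ambient finite-dimensional space and the self-orthogonal subspace
  set V := degV J F D with hV
  set B : LinearMap.BilinForm F V := (residueForm G E).restrict V with hB
  set M0 : Submodule F V := (Mt.restrictScalars F).comap V.subtype with hM0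
  have hBM : B.orthogonal M0 ≤ M0 := by
    intro q hq
    refine hself q.1 fun p hp => dvd_pairing_of_residueForm hE Mt hEM (fun p hp hpV => ?_) hp
    exact LinearMap.BilinForm.mem_orthogonal_iff.1 hq ⟨p, hpV⟩ hp
  have hVd : finrank F V = d * D := finrank_degV D
  set P : ℕ → Submodule F V := fun k => (degV J F k).comap V.subtype with hP
  have hPd : ∀ k ≤ D, finrank F (P k) = d * k := fun k hk => by
    rw [← finrank_degV (F := F) (J := J) k]
    exact (Submodule.comapSubtypeEquivOfLe (degV_mono hk)).finrank_eq
  have h1 := finrank_le_add_finrank_orthogonal B M0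
  have h2 := Submodule.finrank_mono hBM
  have h3 := finrank_add_le_finrank_inf M0 (P (κ + e))
  have h4 := finrank_add_le_finrank_inf (B.orthogonal M0) (P (κ' + e))
  rw [hPd _ (by omega)] at h3
  rw [hPd _ (by omega)] at h4
  rw [hVd] at h1 h3 h4
  rw [hdeg] at h1 h3 h4
  have hκd : d * κ ≤ finrank F (M0 ⊓ P (κ + e) : Submodule F V) := by
    nlinarith
  have hsum : A.card * d ≤ finrank F (M0 ⊓ P (κ + e) : Submodule F V) +
      finrank F (B.orthogonal M0 ⊓ P (κ' + e) : Submodule F V) := by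
    rw [← hA]; nlinarith
  have hWM : B.orthogonal M0 ⊓ P (κ' + e) ≤ M0 ⊓ P (κ + e) :=
    inf_le_inf hBM (Submodule.comap_mono (degV_mono (by omega)))
  set M := M0 ⊓ P (κ + e) with hM
  set W := B.orthogonal M0 ⊓ P (κ' + e) with hW
  set ev : V →ₗ[F] (A × J → F) := (evalMap A U).comp V.subtype with hev
  have hinj : ∀ p ∈ M, ev p = 0 → p = 0 := by
    intro p hp h0
    by_contra hne
    have := hzero p.1 hp.1 (fun h => hne (Subtype.ext h)) hp.2
    have hall : {x | evalMap A U p.1 x = 0} = Set.univ :=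
      Set.eq_univ_of_forall fun x => congrFun h0 x
    rw [hall, Set.ncard_univ, Nat.card_eq_fintype_card, Fintype.card_prod, Fintype.card_coe, ← hd] at this
    omega
  have hfr : ∀ N ≤ M, finrank F (N.map ev) = finrank F N := fun N hN => by
    have hi : Function.Injective (ev.domRestrict N) := by
      intro p p' hpp
      have h0 : ev (p.1 - p'.1) = 0 := by
        rw [map_sub]; exact sub_eq_zero.2 hpp
      exact Subtype.ext (sub_eq_zero.1 (hinj _ (hN (N.sub_mem p.2 p'.2)) h0))
    rw [← LinearMap.range_domRestrict]
    exact LinearMap.finrank_range_of_inj hi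
  set w : A × J → F := fun x => Lagrange.nodalWeight A id (x.1 : F) / E.eval (x.1 : F) with hw
  have hw0 : ∀ i, w i ≠ 0 := fun i =>
    div_ne_zero (Lagrange.nodalWeight_ne_zero Function.injective_id.injOn i.1.2)
      (hAE _ i.1.2)
  have hZA : 0 < A.card := by
    rcases Nat.eq_zero_or_pos A.card with h | h
    · rw [h] at hZ; omega
    · exact h
  have hWC : W.map ev ≤ (weightForm w).orthogonal (M.map ev) := by
    rintro _ ⟨q, hq, rfl⟩
    rw [LinearMap.BilinForm.mem_orthogonal_iff]
    rintro _ ⟨p, hp, rfl⟩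
    have hdvd : E ∣ pairing G p.1 q.1 :=
      dvd_pairing_of_residueForm hE Mt hEM (fun p hp hpV =>
        LinearMap.BilinForm.mem_orthogonal_iff.1 hq.1 ⟨p, hpV⟩ hp) hp.1
    obtain ⟨T, hT⟩ := hdvd
    have hdT : T.degree < ((A.card - 1 : ℕ) : WithBot ℕ) := by
      by_cases hT0 : T = 0
      · rw [hT0, degree_zero]; exact WithBot.bot_lt_coe _
      have hp' : p.1 ∈ degV J F ((κ + e - 1) + 1) := by
        rw [Nat.sub_add_cancel (by omega)]; exact hp.2
      have : (pairing G p.1 q.1).degree < _ := degree_pairing_lt hp' hq.2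
      rw [hT, degree_eq_natDegree (mul_ne_zero hE.ne_zero hT0),
        natDegree_mul hE.ne_zero hT0] at this
      rw [degree_eq_natDegree hT0]
      norm_cast at this ⊢
      omega
    change weightForm w (ev p) (ev q) = 0
    rw [weightForm_apply, Fintype.sum_prod_type]
    have hfib : ∀ a : A, ∑ h, w (a, h) * ev p (a, h) * ev q (a, h) =
        T.eval (a : F) * Lagrange.nodalWeight A id (a : F) := fun a => by
      have := sum_evalMap_mul (hU a a.2) p.1 q.1
      rw [hT, eval_mul] at this
      simp only [hw, mul_assoc, ← Finset.mul_sum]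
      change _ * ∑ h, evalMap A U p.1 (a, h) * evalMap A U q.1 (a, h) = _
      rw [this]
      have := hAE a a.2
      field_simp
    rw [Finset.sum_congr rfl fun a _ => hfib a,
      Finset.sum_coe_sort A fun a => T.eval a * Lagrange.nodalWeight A id a]
    have hc := Lagrange.coeff_eq_sum (s := A) (v := id) Function.injective_id.injOn
      (hdT.trans_le (by exact_mod_cast Nat.sub_le _ _))
    rw [coeff_eq_zero_of_degree_lt hdT] at hc
    rw [hc]
    refine Finset.sum_congr rfl fun a _ => ?_
    rw [Lagrange.nodalWeight, Finset.prod_inv_distrib, div_eq_mul_inv, id]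
  have hdim := finrank_add_finrank_weightForm_orthogonal hw0 (M.map ev)
  have heq : W.map ev = (weightForm w).orthogonal (M.map ev) := by
    refine Submodule.eq_of_le_of_finrank_le hWC ?_
    rw [hfr M le_rfl, Fintype.card_prod, Fintype.card_coe] at hdim
    rw [hfr W hWM]
    rw [← hd] at hdim
    omega
  refine ⟨w, hw0, M.map ev, fun x hx => ?_, ?_, ?_⟩
  · refine Submodule.map_mono hWM ?_
    rw [heq, LinearMap.BilinForm.mem_orthogonal_iff]
    intro y hy
    change weightForm w y x = 0
    rw [weightForm_apply, ← hx y hy]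
    exact Finset.sum_congr rfl fun i _ => by ring
  · rw [hfr M le_rfl]; exact hκd
  · rintro _ ⟨p, hp, rfl⟩ h0
    have := hzero p.1 hp.1 (fun h => h0 (by rw [Subtype.ext (a1 := p) (a2 := 0) h, map_zero])) hp.2
    have hcompl := Set.ncard_add_ncard_compl {x | evalMap A U p.1 x = 0}
    rw [Nat.card_eq_fintype_card, Fintype.card_prod, Fintype.card_coe, ← hd] at hcompl
    change _ ≤ Z + {x | evalMap A U p.1 x = 0}ᶜ.ncard
    omega

end Code

section Determinant

variable {F J : Type*} [Field F] [Fintype J] [DecidableEq J]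

theorem X_sub_C_pow_dvd_det {M : Matrix J J F[X]} {a : F} {U : Matrix J J F} (hU : U.det ≠ 0)
    {c : J → F} (h : M.map (eval a) * U = U * Matrix.diagonal c) :
    (X - C a) ^ {i | c i = 0}.ncard ∣ M.det := by
  classical
  set N : Matrix J J F[X] := U⁻¹.map C * M * U.map C with hN
  have hunit : IsUnit U.det := isUnit_iff_ne_zero.2 hU
  have hdet : N.det = M.det := by
    have h1 : (U⁻¹.map C : Matrix J J F[X]).det * (U.map C : Matrix J J F[X]).det = 1 := by
      rw [← Matrix.det_mul, ← Matrix.map_mul, Matrix.nonsing_inv_mul U hunit,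
        Matrix.map_one _ C_0 C_1, Matrix.det_one]
    rw [hN, Matrix.det_mul, Matrix.det_mul, mul_right_comm, h1, one_mul]
  have hNa : ∀ i j, (N i j).eval a = (Matrix.diagonal c) i j := by
    have h2 : N.map (eval a) = Matrix.diagonal c := by
      have : N.map (evalRingHom a) = U⁻¹ * (M.map (eval a) * U) := by
        rw [hN, Matrix.map_mul, Matrix.map_mul, Matrix.map_map, Matrix.map_map, mul_assoc]
        congr 1
        · ext i j; simp
        · congr 1
          ext i j; simp
      rw [h, Matrix.nonsing_inv_mul_cancel_left _ _ hunit] at this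
      exact this
    exact fun i j => congrFun (congrFun h2 i) j
  rw [← hdet, Matrix.det_apply]
  refine Finset.dvd_sum fun σ _ => ?_
  refine Dvd.dvd.trans ?_ (Units.smul_def (Equiv.Perm.sign σ) (∏ i, N (σ i) i) ▸
    dvd_smul_of_dvd _ dvd_rfl)
  have hz : (X - C a) ^ {i | c i = 0}.ncard = ∏ i, if c i = 0 then (X - C a) else 1 := by
    rw [Finset.prod_ite, Finset.prod_const, Finset.prod_const_one, mul_one,
      Set.ncard_eq_toFinset_card']
    congr 2
    ext i; simp
  rw [hz]
  refine Finset.prod_dvd_prod_of_dvd _ _ fun i _ => ?_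
  split_ifs with hi
  · rw [dvd_iff_isRoot, IsRoot, hNa, Matrix.diagonal_apply]
    split_ifs with h3
    · rwa [h3]
    · rfl
  · exact one_dvd _

theorem prod_X_sub_C_pow_dvd {A : Finset F} {z : F → ℕ} {P : F[X]}
    (h : ∀ a ∈ A, (X - C a) ^ z a ∣ P) : ∏ a ∈ A, (X - C a) ^ z a ∣ P := by
  refine Finset.prod_dvd_of_coprime (fun a _ b _ hab => ?_) h
  exact (pairwise_coprime_X_sub_C Function.injective_id hab).pow

theorem sum_le_natDegree {A : Finset F} {z : F → ℕ} {P : F[X]} (hP : P ≠ 0)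
    (h : ∏ a ∈ A, (X - C a) ^ z a ∣ P) : ∑ a ∈ A, z a ≤ P.natDegree := by
  have := natDegree_le_of_dvd h hP
  rw [natDegree_prod _ _ fun a _ => pow_ne_zero _ (X_sub_C_ne_zero a)] at this
  simpa [natDegree_pow] using this

end Determinant

section Gram

/-- The Gram matrix of the monomial basis for the trace form of a fibre. -/
def gram (R : Type*) [CommRing R] (r m : ℕ) (i j : Fin m → Fin r) : R :=
  ∏ l, Setup.powSum R r ((i l : ℕ) + j l)

theorem map_powSum {R T : Type*} [CommRing R] [CommRing T] (f : R →+* T) (r k : ℕ) :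
    f (Setup.powSum R r k) = Setup.powSum T r k := by
  simp only [Setup.powSum]
  split_ifs <;> simp

theorem map_gram {R T : Type*} [CommRing R] [CommRing T] (f : R →+* T) {r m : ℕ}
    (i j : Fin m → Fin r) : f (gram R r m i j) = gram T r m i j := by
  simp only [gram, map_prod, map_powSum]

theorem sum_powSum_mul (R : Type*) [CommRing R] {r : ℕ} (hr : 2 ≤ r) (i j : Fin r) :
    ∑ k : Fin r, Setup.powSum R r ((i : ℕ) + k) *
      ((if (k : ℕ) = r - 1 - j then 1 else 0) +
        if (j : ℕ) = 0 then (if (k : ℕ) = 0 then 1 else 0) else 0) = if i = j then 1 else 0 := by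
  have hi := i.2
  have hj := j.2
  simp only [mul_add, Finset.sum_add_distrib]
  rw [Finset.sum_eq_single ⟨r - 1 - j, by omega⟩
    (fun b _ hb => by rw [if_neg (fun h => hb (Fin.ext h)), mul_zero]) (by simp),
    Finset.sum_eq_single (⟨0, by omega⟩ : Fin r)
    (fun b _ hb => by rw [if_neg (fun h : (b : ℕ) = 0 => hb (Fin.ext h))]; simp) (by simp)]
  simp only [Setup.powSum, Fin.ext_iff, if_true]
  split_ifs <;> first | omega | simp

theorem gram_det_ne_zero (R : Type*) [Field R] {r : ℕ} (hr : 2 ≤ r) (m : ℕ) :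
    (Matrix.of (gram R r m)).det ≠ 0 := by
  set A : Matrix (Fin m → Fin r) (Fin m → Fin r) R := Matrix.of fun k j =>
    ∏ l, ((if (k l : ℕ) = r - 1 - j l then 1 else 0) +
      if (j l : ℕ) = 0 then (if (k l : ℕ) = 0 then 1 else 0) else 0) with hA
  have h : Matrix.of (gram R r m) * A = 1 := by
    ext i j
    simp only [Matrix.mul_apply, hA, Matrix.of_apply, gram, ← Finset.prod_mul_distrib]
    rw [← Fintype.prod_sum fun l (k : Fin r) => Setup.powSum R r ((i l : ℕ) + k) *
      ((if (k : ℕ) = r - 1 - j l then 1 else 0) +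
        if (j l : ℕ) = 0 then (if (k : ℕ) = 0 then 1 else 0) else 0)]
    simp only [sum_powSum_mul R hr]
    rw [Matrix.one_apply, Finset.prod_ite_zero, Finset.prod_const_one]
    simp only [Finset.mem_univ, true_imp_iff, funext_iff]
  intro h0
  have := congrArg Matrix.det h
  rw [Matrix.det_mul, h0, zero_mul, Matrix.det_one] at this
  exact zero_ne_one this

variable {L : Type*} [Field L] [IsAlgClosed L] {r : ℕ} {Ω : Finset L} {m : ℕ}

namespace Setup

theorem sum_mon_mul_mon (s : Setup L r Ω) (a : L) (i j : Fin m → Fin r) :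
    ∑ h : Fin m → Ω, mon i (pt r (ext h) a) * mon j (pt r (ext h) a) = gram L r m i j := by
  rw [gram, ← s.sum_prod_pow (fun l => (i l : ℕ) + j l) (fun l => by
    have := (i l).2; have := (j l).2; omega) a]
  refine Finset.sum_congr rfl fun h _ => ?_
  simp only [mon, ← Finset.prod_mul_distrib, pow_add]

/-- A labelling of the fibres by the index set of the monomials. -/
noncomputable def label (s : Setup L r Ω) (m : ℕ) : (Fin m → Fin r) ≃ (Fin m → Ω) :=
  Equiv.arrowCongr (Equiv.refl _) (Ω.equivFinOfCardEq s.card).symm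

/-- The point over `a` with label `h`. -/
noncomputable def fib (s : Setup L r Ω) (a : L) (h : Fin m → Fin r) : ℕ → L :=
  pt r (ext (s.label m h)) a

theorem fib_zero (s : Setup L r Ω) (a : L) (h : Fin m → Fin r) : s.fib a h 0 = a := rfl

theorem isPoint_fib (s : Setup L r Ω) {a : L} (ha : S r a ≠ 0) (h : Fin m → Fin r) :
    IsPoint r (s.fib a h) := s.isPoint _ ha

theorem sum_fib (s : Setup L r Ω) (a : L) (i j : Fin m → Fin r) :
    ∑ h : Fin m → Fin r, mon i (s.fib a h) * mon j (s.fib a h) = gram L r m i j := by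
  rw [← s.sum_mon_mul_mon a i j, ← (s.label m).sum_comp]
  rfl

end Setup

end Gram

section Descent

variable {F L : Type*} [Field F] [Fintype F] [Field L] [Algebra F L] {r : ℕ}

omit [Fintype F] in
theorem algebraMap_S (z : F) : algebraMap F L (S r z) = S r (algebraMap F L z) := by
  simp [S]

/-- The arithmetic of the finite field with `r ^ 2` elements used by the tower. -/
structure Base (F : Type*) [Field F] (r : ℕ) (Ω : Finset F) : Prop where
  mem : ∀ z, z ∈ Ω ↔ S r z = 0
  card : Ω.card = r
  surj : ∀ c : F, c ^ r = c → ∃ z, S r z = c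
  pow : ∀ z : F, z ^ (r * r) = z

variable {Ω : Finset F}

namespace Base

variable (L) in
/-- The roots of `z ^ r + z` in an extension. -/
def roots (_ : Base F r Ω) : Finset L := Ω.map ⟨algebraMap F L, (algebraMap F L).injective⟩

omit [Fintype F] in
theorem exists_coord (b : Base F r Ω) (s : Setup L r (b.roots L))
    {ξ : ℕ → L} (hξ : IsPoint r ξ) {a : F} (h0 : ξ 0 = algebraMap F L a) (l : ℕ) :
    ∃ c : F, ξ l = algebraMap F L c := by
  induction l with
  | zero => exact ⟨a, h0⟩
  | succ l ih =>
    obtain ⟨c, hc⟩ := ih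
    have hfrob : ∀ x y : F, (x + y) ^ r = x ^ r + y ^ r := fun x y =>
      (algebraMap F L).injective (by simpa using s.add_pow _ _)
    have hfix : (c ^ (r + 1) / S r c) ^ r = c ^ (r + 1) / S r c := by
      have h1 : (c ^ (r + 1)) ^ r = c ^ (r + 1) := by
        rw [← pow_mul, show (r + 1) * r = r * r + r by ring, pow_add, b.pow, pow_succ']
      have h2 : S r c ^ r = S r c := by
        rw [S, hfrob, ← pow_mul, b.pow, add_comm]
      rw [div_pow, h1, h2]
    obtain ⟨z, hz⟩ := b.surj _ hfix
    have h3 : S r (ξ (l + 1) - algebraMap F L z) = 0 := by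
      rw [S_sub s.add_pow, ← algebraMap_S, hz, hξ.S_succ s.one_le, hc, map_div₀, map_pow,
        algebraMap_S, sub_self]
    obtain ⟨ω, -, hω⟩ := Finset.mem_map.1 (s.mem_iff.2 h3)
    exact ⟨z + ω, by rw [map_add]; exact (sub_eq_iff_eq_add'.1 hω.symm)⟩

omit [Fintype F] in
theorem setup (b : Base F r Ω) {p k : ℕ} [Fact p.Prime] [CharP F p] (hr : r = p ^ k) (h3 : 3 ≤ r) :
    Setup L r (b.roots L) := by
  have : CharP L p := charP_of_injective_algebraMap (algebraMap F L).injective p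
  have hadd : ∀ x y : L, (x + y) ^ r = x ^ r + y ^ r := fun x y => by
    rw [hr]; exact add_pow_char_pow x y p k
  have hk : k ≠ 0 := fun h => by rw [h, pow_zero] at hr; omega
  refine ⟨h3, ?_, hadd, fun z => ?_, ?_, fun β hβ => ?_⟩
  · rw [hr, Nat.cast_pow, CharP.cast_eq_zero, zero_pow hk]
  · have hlt : (X : F[X]).degree < (r : WithBot ℕ) := by
      rw [degree_X]; exact_mod_cast (by omega : 1 < r)
    have hdeg : (X ^ r + X : F[X]).degree = r := by
      rw [degree_add_eq_left_of_degree_lt (by rwa [degree_X_pow]), degree_X_pow]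
    have hmon : (X ^ r + X : F[X]).Monic := monic_X_pow_add hlt
    have hprod : (X ^ r + X : F[X]) = ∏ ω ∈ Ω, (X - C ω) := by
      have hmon' : (∏ ω ∈ Ω, (X - C ω) : F[X]).Monic := monic_prod_of_monic _ _ fun ω _ => monic_X_sub_C ω
      have hdeg' : (∏ ω ∈ Ω, (X - C ω) : F[X]).degree = r := by
        rw [degree_eq_natDegree hmon'.ne_zero, natDegree_prod_of_monic _ _ fun ω _ => monic_X_sub_C ω]
        simp [b.card]
      refine eq_of_degree_sub_lt_of_eval_finset_eq Ω ?_ fun ω hω => ?_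
      · rw [b.card, ← hdeg]
        exact degree_sub_lt_left (hdeg.trans hdeg'.symm) hmon.ne_zero
          (hmon.leadingCoeff.trans hmon'.leadingCoeff.symm)
      · have h1 := (b.mem ω).1 hω
        rw [eval_prod, Finset.prod_eq_zero hω (by simp)]
        simpa [S] using h1
    have := congrArg (aeval z) hprod
    simpa [roots, S] using this
  · rw [roots, Finset.card_map, b.card]
  · obtain ⟨c, -, rfl⟩ := Finset.mem_map.1 hβ
    have h1 : (c ^ (r + 1)) ^ r = c ^ (r + 1) := by
      rw [← pow_mul, show (r + 1) * r = r * r + r by ring, pow_add, b.pow, pow_succ']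
    have := congrArg (algebraMap F L) h1
    simpa using this

end Base

theorem exists_base {p k : ℕ} [Fact p.Prime] [CharP F p] [DecidableEq F]
    (hcard : Fintype.card F = p ^ k * p ^ k) (h1 : 1 < p ^ k) :
    Base F (p ^ k) (Finset.univ.filter fun z : F => S (p ^ k) z = 0) := by
  set r := p ^ k with hr
  have hadd : ∀ x y : F, (x + y) ^ r = x ^ r + y ^ r := fun x y => add_pow_char_pow x y p k
  have hpow : ∀ z : F, z ^ (r * r) = z := fun z => by rw [← hcard, FiniteField.pow_card]
  have hfix : ∀ z : F, S r z ^ r = S r z := fun z => by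
    rw [S, hadd, ← pow_mul, hpow, add_comm]
  have hlt : (X : F[X]).degree < (r : WithBot ℕ) := by
    rw [degree_X]; exact_mod_cast h1
  have hbound : ∀ (P : F[X]) (T : Finset F), P ≠ 0 → (∀ z ∈ T, P.eval z = 0) →
      T.card ≤ P.natDegree := fun P T h0 hT => by
    by_contra hc
    exact h0 (eq_zero_of_natDegree_lt_card_of_eval_eq_zero' P T hT (by omega))
  have hdeg : ∀ Q : F[X], Q.degree < (r : WithBot ℕ) →
      (X ^ r + Q).natDegree = r ∧ X ^ r + Q ≠ 0 := fun Q hQ => by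
    have h := degree_add_eq_left_of_degree_lt (p := (X ^ r : F[X])) (q := Q) (by rwa [degree_X_pow])
    rw [degree_X_pow] at h
    exact ⟨natDegree_eq_of_degree_eq_some h, fun h0 => by simp [h0] at h⟩
  set T := Finset.univ.filter fun z : F => z ^ r = z with hT
  have hTle : T.card ≤ r := by
    obtain ⟨h2, h3⟩ := hdeg (-X) (by rwa [degree_neg])
    refine (hbound _ T h3 fun z hz => ?_).trans_eq h2
    · have : z ^ r = z := by simpa [hT] using hz
      simp [this]
  have hle : ∀ c, (Finset.univ.filter fun z : F => S r z = c).card ≤ r := fun c => by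
    obtain ⟨h2, h3⟩ := hdeg (X + C (-c)) (by rw [degree_X_add_C]; exact_mod_cast h1)
    refine (hbound _ _ h3 fun z hz => ?_).trans_eq h2
    · have : z ^ r + z = c := (Finset.mem_filter.1 hz).2
      simp [← add_assoc, this]
  have hcount : r * r = ∑ c ∈ T, (Finset.univ.filter fun z : F => S r z = c).card := by
    rw [← hcard, ← Finset.card_univ]
    exact Finset.card_eq_sum_card_fiberwise fun z _ => by simpa [hT] using hfix z
  have heq : ∀ c ∈ T, (Finset.univ.filter fun z : F => S r z = c).card = r := fun c hc => by
    by_contra hne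
    have hlt' := Finset.sum_lt_sum (s := T) (fun c _ => hle c) ⟨c, hc, lt_of_le_of_ne (hle c) hne⟩
    rw [← hcount, Finset.sum_const, smul_eq_mul] at hlt'
    exact absurd (hlt'.trans_le (Nat.mul_le_mul_right r hTle)) (lt_irrefl _)
  refine ⟨fun z => by simp, heq 0 (by simp [hT]; omega), fun c hc => ?_, hpow⟩
  have h2 := heq c (by simpa [hT] using hc)
  obtain ⟨z, hz⟩ := Finset.card_pos.1 (h2 ▸ (by omega : 0 < r))
  exact ⟨z, (Finset.mem_filter.1 hz).2⟩

end Descent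

section Places

theorem exists_valuationSubring_notMem {R L : Type*} [CommRing R] [Field L] [Algebra R L] {y : L}
    (hy : ¬ IsIntegral R y) :
    ∃ V : ValuationSubring L, (∀ a : R, algebraMap R L a ∈ V) ∧ y ∉ V := by
  by_contra! h
  have hmem : y ∈ (⨅ V : {V : ValuationSubring L //
      Set.range (algebraMap R L) ⊆ V.toSubring}, V.1.toSubring) := by
    rw [Subring.mem_iInf]
    exact fun V => h V.1 fun a => V.2 ⟨a, rfl⟩
  rw [iInf_valuationSubring_superset] at hmem
  have h_int : IsIntegral (Subring.closure (Set.range (algebraMap R L))) y := hmem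
  refine hy ?_
  obtain ⟨P, hP, hPy⟩ := h_int
  have hcl : Subring.closure (Set.range (algebraMap R L)) = (algebraMap R L).range := by
    rw [← RingHom.coe_range, Subring.closure_eq]
  have hlift : P.map (algebraMap _ L) ∈ lifts (algebraMap R L) := by
    rw [lifts_iff_coeff_lifts]
    intro n
    rw [coeff_map]
    exact hcl.le (P.coeff n).2
  obtain ⟨Q, hQ, -, hQm⟩ := lifts_and_natDegree_eq_and_monic hlift (hP.map _)
  refine ⟨Q, hQm, ?_⟩
  rw [← eval_map, hQ, eval_map]
  exact hPy

variable {F L : Type*} [Field F] [Field L]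

theorem dvd_of_valuation_le [Algebra F[X] L] [Algebra (RatFunc F) L]
    [IsScalarTower F[X] (RatFunc F) L] {A B : F[X]} (hA : A ≠ 0)
    (h : ∀ V : ValuationSubring L, (∀ a : F[X], algebraMap F[X] L a ∈ V) →
      V.valuation (algebraMap F[X] L B) ≤ V.valuation (algebraMap F[X] L A)) : A ∣ B := by
  set y : RatFunc F := algebraMap F[X] (RatFunc F) B / algebraMap F[X] (RatFunc F) A with hy
  have hA' : algebraMap F[X] (RatFunc F) A ≠ 0 := by
    simpa using hA
  have hAL : algebraMap F[X] L A ≠ 0 := by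
    rw [IsScalarTower.algebraMap_apply F[X] (RatFunc F) L]
    simpa using hA
  have h_int : IsIntegral F[X] (algebraMap (RatFunc F) L y) := by
    by_contra hni
    obtain ⟨V, hV, hyV⟩ := exists_valuationSubring_notMem hni
    refine hyV ?_
    rw [← V.valuation_le_one_iff, hy, map_div₀, ← IsScalarTower.algebraMap_apply,
      ← IsScalarTower.algebraMap_apply, map_div₀]
    exact div_le_one_of_le₀ (h V hV) zero_le
  rw [isIntegral_algebraMap_iff (algebraMap (RatFunc F) L).injective,
    IsIntegrallyClosed.isIntegral_iff] at h_int
  obtain ⟨c, hc⟩ := h_int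
  refine ⟨c, IsFractionRing.injective F[X] (RatFunc F) ?_⟩
  rw [map_mul, hc, hy, mul_div_cancel₀ _ hA']

theorem exists_infinite_place [Algebra F L] {x : L} (hx : Transcendental F x) :
    ∃ V : ValuationSubring L, V.valuation.IsTrivialOn F ∧ 1 < V.valuation x := by
  have hni : ¬ IsIntegral F x := fun h => hx h.isAlgebraic
  obtain ⟨V, hV, hxV⟩ := exists_valuationSubring_notMem hni
  refine ⟨V, ⟨fun a ha => le_antisymm ((V.valuation_le_one_iff _).2 (hV a)) ?_⟩, ?_⟩
  · have h1 := (V.valuation_le_one_iff _).2 (hV a⁻¹)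
    rw [map_inv₀, map_inv₀] at h1
    exact (inv_le_one₀ (zero_lt_iff.2 (by simpa using ha))).1 h1
  · rwa [← not_le, V.valuation_le_one_iff]

end Places

section Infinity

variable {F L : Type*} [Field F] [Field L] [Algebra F L] {r : ℕ}
variable {Γ : Type*} [LinearOrderedCommGroupWithZero Γ] (v : Valuation L Γ)

/-- The value at a point of a polynomial combination of the monomial basis. -/
noncomputable def value {m : ℕ} (p : (Fin m → Fin r) → F[X]) (ξ : ℕ → L) : L :=
  ∑ j, aeval (ξ 0) (p j) * Setup.mon j ξ

theorem mon_snoc {m : ℕ} (j : Fin m → Fin r) (k : Fin r) (ξ : ℕ → L) :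
    Setup.mon (Fin.snoc j k : Fin (m + 1) → Fin r) ξ = Setup.mon j ξ * ξ (m + 1) ^ (k : ℕ) := by
  simp [Setup.mon, Fin.prod_univ_castSucc]

theorem value_succ {m : ℕ} (p : (Fin (m + 1) → Fin r) → F[X]) (ξ : ℕ → L) :
    value p ξ = ∑ k, value (fun j => p (Fin.snoc j k)) ξ * ξ (m + 1) ^ (k : ℕ) := by
  rw [value, ← (Fin.snocEquiv (fun _ => Fin r)).sum_comp, Fintype.sum_prod_type]
  refine Finset.sum_congr rfl fun k _ => ?_
  rw [value, Finset.sum_mul]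
  refine Finset.sum_congr rfl fun j _ => ?_
  simp only [Fin.snocEquiv, Equiv.coe_fn_mk]
  rw [mon_snoc, mul_assoc]

theorem IsPoint.one_lt_v {ξ : ℕ → L} (hξ : IsPoint r ξ) (hr : 2 ≤ r) (h : 1 < v (ξ 0)) (m : ℕ) :
    1 < v (ξ m) := by
  induction m with
  | zero => exact h
  | succ m ih => exact hξ.v_gt_of_gt v hr ih

theorem exists_v_value_eq [v.IsTrivialOn F] {ξ : ℕ → L} (hξ : IsPoint r ξ) (hr : 2 ≤ r)
    (h : 1 < v (ξ 0)) {m : ℕ} {p : (Fin m → Fin r) → F[X]} (hp : p ≠ 0) :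
    ∃ e : ℕ, v (value p ξ) = v (ξ m) ^ e := by
  classical
  induction m with
  | zero =>
    have hp0 : p Fin.elim0 ≠ 0 := fun h0 => hp (funext fun j => by
      rw [Subsingleton.elim j Fin.elim0, h0, Pi.zero_apply])
    refine ⟨(p Fin.elim0).natDegree, ?_⟩
    rw [← valuation_aeval_eq_valuation_X_pow_natDegree_of_one_lt_valuation_X (v := v) _ h hp0]
    rw [value, Fintype.sum_unique]
    simp only [Setup.mon, Finset.univ_eq_empty, Finset.prod_empty, mul_one]
    congr!
  | succ m ih =>
    set w := v (ξ (m + 1)) with hw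
    have hw1 : 1 < w := hξ.one_lt_v v hr h (m + 1)
    have hwr : w ^ r = v (ξ m) := hξ.v_succ_of_gt v hr (hξ.one_lt_v v hr h m)
    set q : Fin r → (Fin m → Fin r) → F[X] := fun k j => p (Fin.snoc j k) with hq
    have hterm : ∀ k, q k ≠ 0 → ∃ e : ℕ,
        v (value (q k) ξ * ξ (m + 1) ^ (k : ℕ)) = w ^ (r * e + k) := by
      intro k hk
      obtain ⟨e, he⟩ := ih hk
      exact ⟨e, by rw [map_mul, he, map_pow, ← hwr, pow_add, pow_mul]⟩
    choose! e he using hterm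
    have hne : (Finset.univ.filter fun k => q k ≠ 0).Nonempty := by
      by_contra hempty
      rw [Finset.not_nonempty_iff_eq_empty, Finset.filter_eq_empty_iff] at hempty
      refine hp (funext fun j => ?_)
      have h1 := congrFun (not_not.1 (hempty (Finset.mem_univ (j (Fin.last m))))) (Fin.init j)
      simpa [hq] using h1
    obtain ⟨k, hk, hmax⟩ := Finset.exists_max_image _ (fun k : Fin r => r * e k + k) hne
    rw [Finset.mem_filter] at hk
    refine ⟨r * e k + k, ?_⟩
    rw [value_succ, ← he k hk.2]
    refine Valuation.map_sum_eq_of_lt _ (Finset.mem_univ k) fun k' hk' => ?_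
    change v (value (q k') ξ * ξ (m + 1) ^ (k' : ℕ)) < v (value (q k) ξ * ξ (m + 1) ^ (k : ℕ))
    rw [he k hk.2]
    by_cases hk0 : q k' = 0
    · have h0 : value (q k') ξ = 0 := by simp [hk0, value]
      rw [h0, zero_mul, map_zero]
      exact pow_pos (zero_lt_one.trans hw1) _
    · rw [he k' hk0]
      refine pow_lt_pow_right₀ hw1 (lt_of_le_of_ne (hmax k' (by simpa using hk0)) fun heq => ?_)
      have h1 := congrArg (· % r) heq
      simp only [Nat.mul_add_mod, Nat.mod_eq_of_lt k.2, Nat.mod_eq_of_lt k'.2] at h1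
      exact (Finset.mem_sdiff.1 hk').2 (Finset.mem_singleton.2 (Fin.ext h1))

theorem value_ne_zero [v.IsTrivialOn F] {ξ : ℕ → L} (hξ : IsPoint r ξ) (hr : 2 ≤ r)
    (h : 1 < v (ξ 0)) {m : ℕ} {p : (Fin m → Fin r) → F[X]} (hp : p ≠ 0) : value p ξ ≠ 0 := by
  obtain ⟨e, he⟩ := exists_v_value_eq v hξ hr h hp
  rw [← v.ne_zero_iff, he]
  exact pow_ne_zero _ (zero_lt_one.trans (hξ.one_lt_v v hr h m)).ne'

theorem v_mon_mul_le {ξ : ℕ → L} (hξ : IsPoint r ξ) (hr : 2 ≤ r) (h : 1 < v (ξ 0)) {m : ℕ}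
    (j : Fin m → Fin r) : v (Setup.mon j ξ) * v (ξ m) ≤ v (ξ 0) := by
  induction m with
  | zero => simp [Setup.mon]
  | succ m ih =>
    have hw1 : 1 < v (ξ (m + 1)) := hξ.one_lt_v v hr h (m + 1)
    have hwr := hξ.v_succ_of_gt v hr (hξ.one_lt_v v hr h m)
    have hj := (j (Fin.last m)).2
    rw [← Fin.snoc_init_self j, mon_snoc, map_mul, map_pow, mul_assoc, ← pow_succ]
    refine le_trans ?_ (ih (Fin.init j))
    rw [← hwr]
    exact mul_le_mul_right (pow_le_pow_right₀ hw1.le (by omega)) _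

theorem v_mon_le {ξ : ℕ → L} (hξ : IsPoint r ξ) (hr : 2 ≤ r) (h : 1 < v (ξ 0)) {m : ℕ}
    (j : Fin m → Fin r) : v (Setup.mon j ξ) ≤ v (ξ 0) :=
  le_trans (le_mul_of_one_le_right' (hξ.one_lt_v v hr h m).le) (v_mon_mul_le v hξ hr h j)

theorem v_value_le [v.IsTrivialOn F] {ξ : ℕ → L} (hξ : IsPoint r ξ) (hr : 2 ≤ r)
    (h : 1 < v (ξ 0)) {m k : ℕ} {p : (Fin m → Fin r) → F[X]}
    (hp : ∀ j, (p j).degree < (k : WithBot ℕ)) : v (value p ξ) ≤ v (ξ 0) ^ k := by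
  refine v.map_sum_le fun j _ => ?_
  rw [map_mul]
  by_cases hj : p j = 0
  · simp [hj]
  have hd : (p j).natDegree < k := (natDegree_lt_iff_degree_lt hj).2 (hp j)
  rw [valuation_aeval_eq_valuation_X_pow_natDegree_of_one_lt_valuation_X (v := v) _ h hj]
  refine (mul_le_mul_right (v_mon_le v hξ hr h j) _).trans ?_
  rw [← pow_succ]
  exact pow_le_pow_right₀ h.le hd

end Infinity

section Zeros

variable {F L : Type*} [Field F] [Field L] [Algebra F L] {r m : ℕ}

theorem aeval_coord_apply (p : F[X]) (ξ : Point L r) :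
    aeval (coord 0 : Point L r → L) p ξ = aeval (ξ.1 0) p :=
  (aeval_algHom_apply (Pi.evalAlgHom F (fun _ : Point L r => L) ξ) (coord 0) p).symm

theorem aeval_coord_mem (p : F[X]) (m : ℕ) :
    (fun ξ : Point L r => aeval (ξ.1 0) p) ∈ level F L r m := by
  have h : aeval (coord 0 : Point L r → L) p ∈ level F L r 0 := by
    have := (aeval (⟨coord 0, coord_mem 0⟩ : level F L r 0) p).2
    rwa [← Subalgebra.aeval_coe] at this
  convert level_mono m.zero_le h using 1
  exact funext fun ξ => (aeval_coord_apply p ξ).symm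

theorem mon_mem (j : Fin m → Fin r) :
    (fun ξ : Point L r => Setup.mon j ξ.1) ∈ level F L r m := by
  have : (fun ξ : Point L r => Setup.mon j ξ.1) = ∏ l : Fin m, coord ((l : ℕ) + 1) ^ (j l : ℕ) := by
    funext ξ
    simp [Setup.mon, coord]
  rw [this]
  exact prod_mem fun l _ => pow_mem (level_mono (by omega) (coord_mem _)) _

theorem value_mem (p : (Fin m → Fin r) → F[X]) :
    (fun ξ : Point L r => value p ξ.1) ∈ level F L r m := by
  have : (fun ξ : Point L r => value p ξ.1) =
      ∑ j, (fun ξ : Point L r => aeval (ξ.1 0) (p j)) * fun ξ : Point L r => Setup.mon j ξ.1 := by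
    funext ξ
    simp [value]
  rw [this]
  exact sum_mem fun j _ => mul_mem (aeval_coord_mem _ _) (mon_mem j)

theorem exists_mul_expansion (hr : 2 ≤ r) (p : (Fin m → Fin r) → F[X]) :
    ∃ k, ∃ M : Matrix (Fin m → Fin r) (Fin m → Fin r) F[X], ∀ i, ∀ ξ : ℕ → L, IsPoint r ξ →
      S r (ξ 0) ^ k * (value p ξ * Setup.mon i ξ) =
        ∑ j, aeval (ξ 0) (M i j) * Setup.mon j ξ := by
  obtain ⟨k, M, hM⟩ := exists_polynomial_expansion (F := F) (L := L) hr m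
    (f := fun (i : Fin m → Fin r) ξ => value p ξ.1 * Setup.mon i ξ.1)
    (fun i => mul_mem (value_mem p) (mon_mem i))
  exact ⟨k, M, fun i ξ hξ => hM i ⟨ξ, hξ⟩⟩

variable [IsAlgClosed L]

/-- The matrix of the values of the monomials on a fibre. -/
noncomputable def fibMatrix {Ω : Finset L} (s : Setup L r Ω) (m : ℕ) (a : L) :
    Matrix (Fin m → Fin r) (Fin m → Fin r) L :=
  Matrix.of fun i h => Setup.mon i (s.fib a h)

theorem det_ne_zero_of_sum_eq_gram {T : Type*} [Field T] (hr : 2 ≤ r)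
    {U : Matrix (Fin m → Fin r) (Fin m → Fin r) T}
    (h : ∀ i j, ∑ k, U i k * U j k = gram T r m i j) : U.det ≠ 0 := by
  have h1 : U * U.transpose = Matrix.of (gram T r m) := by
    ext i j
    simp [Matrix.mul_apply, h]
  have h2 := gram_det_ne_zero T hr m
  rw [← h1, Matrix.det_mul] at h2
  exact left_ne_zero_of_mul h2

theorem fibMatrix_mul {Ω : Finset L} (s : Setup L r Ω) {a : L} (ha : S r a ≠ 0)
    {p : (Fin m → Fin r) → F[X]} {k : ℕ} {M : Matrix (Fin m → Fin r) (Fin m → Fin r) F[X]}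
    (hM : ∀ i, ∀ ξ : ℕ → L, IsPoint r ξ → S r (ξ 0) ^ k * (value p ξ * Setup.mon i ξ) =
        ∑ j, aeval (ξ 0) (M i j) * Setup.mon j ξ) :
    M.map (aeval a) * fibMatrix s m a =
      fibMatrix s m a * Matrix.diagonal fun h => S r a ^ k * value p (s.fib a h) := by
  ext i h
  rw [Matrix.mul_diagonal]
  have := hM i _ (s.isPoint_fib ha h)
  rw [s.fib_zero] at this
  simp only [Matrix.mul_apply, Matrix.map_apply, fibMatrix, Matrix.of_apply]
  rw [← this]
  ring

theorem aeval_det {Ω : Finset L} (s : Setup L r Ω) {a : L} (ha : S r a ≠ 0)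
    {p : (Fin m → Fin r) → F[X]} {k : ℕ} {M : Matrix (Fin m → Fin r) (Fin m → Fin r) F[X]}
    (hM : ∀ i, ∀ ξ : ℕ → L, IsPoint r ξ → S r (ξ 0) ^ k * (value p ξ * Setup.mon i ξ) =
        ∑ j, aeval (ξ 0) (M i j) * Setup.mon j ξ) :
    aeval a M.det = S r a ^ (k * r ^ m) * ∏ h : Fin m → Fin r, value p (s.fib a h) := by
  have hU : (fibMatrix s m a).det ≠ 0 :=
    det_ne_zero_of_sum_eq_gram s.two_le fun i j => by
      simpa [fibMatrix] using s.sum_fib a i j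
  have h1 := congrArg Matrix.det (fibMatrix_mul s ha hM)
  rw [Matrix.det_mul, Matrix.det_mul, mul_comm] at h1
  have h2 := mul_left_cancel₀ hU h1
  rw [Matrix.det_diagonal, Finset.prod_mul_distrib, Finset.prod_const] at h2
  have h3 : (M.map (aeval a : F[X] →ₐ[F] L)).det = aeval a M.det :=
    (AlgHom.map_det (aeval a : F[X] →ₐ[F] L) M).symm
  rw [← h3, h2, Finset.card_univ, Fintype.card_fun, Fintype.card_fin, Fintype.card_fin, ← pow_mul]

omit [IsAlgClosed L] in
theorem ncard_zeros {J : Type*} [Fintype J] (A : Finset F) (f : F → J → F) :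
    {x : A × J | f x.1 x.2 = 0}.ncard = ∑ a ∈ A, {i | f a i = 0}.ncard := by
  classical
  rw [← Finset.sum_coe_sort A fun a => {i | f a i = 0}.ncard]
  simp only [Set.ncard_eq_toFinset_card', Set.toFinset_ofPred]
  rw [← Fintype.card_subtype, ← Fintype.card_congr (Equiv.sigmaFiberEquiv
    (fun x : {x : A × J // f x.1 x.2 = 0} => x.1.1)), Fintype.card_sigma]
  refine Finset.sum_congr rfl fun a _ => ?_
  rw [← Fintype.card_subtype]
  refine Fintype.card_congr ⟨fun x => ⟨x.1.1.2, ?_⟩, fun i => ⟨⟨(a, i.1), i.2⟩, rfl⟩, ?_, ?_⟩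
  · obtain ⟨⟨⟨b, i⟩, hx⟩, hb⟩ := x
    subst hb
    exact hx
  · rintro ⟨⟨⟨b, i⟩, hx⟩, rfl⟩
    rfl
  · intro i
    rfl

theorem exists_fibMatrix {Ω : Finset F} (b : Base F r Ω) (s : Setup L r (b.roots L)) (m : ℕ) :
    ∃ U : F → (Fin m → Fin r) → (Fin m → Fin r) → F, ∀ a, S r a ≠ 0 →
      (∀ i h, algebraMap F L (U a i h) = Setup.mon i (s.fib (algebraMap F L a) h)) ∧
      ∀ i j, ∑ h, U a i h * U a j h = gram F r m i j := by
  have h1 : ∀ a : F, ∀ i h : Fin m → Fin r, ∃ c : F, S r a ≠ 0 →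
      algebraMap F L c = Setup.mon i (s.fib (algebraMap F L a) h) := fun a i h => by
    by_cases ha : S r a = 0
    · exact ⟨0, fun h => absurd ha h⟩
    have ha' : S r (algebraMap F L a) ≠ 0 := by
      rw [← algebraMap_S]; simpa using ha
    choose c hc using fun l => b.exists_coord s (s.isPoint_fib ha' h) (s.fib_zero _ h) l
    refine ⟨∏ l : Fin m, c (l + 1) ^ (i l : ℕ), fun _ => ?_⟩
    rw [map_prod, Setup.mon]
    exact Finset.prod_congr rfl fun l _ => by rw [map_pow, hc]
  choose U hU using h1
  refine ⟨U, fun a ha => ⟨fun i h => hU a i h ha, fun i j => (algebraMap F L).injective ?_⟩⟩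
  rw [map_gram, ← s.sum_fib (algebraMap F L a) i j, map_sum]
  exact Finset.sum_congr rfl fun h _ => by rw [map_mul, hU a i h ha, hU a j h ha]

variable [Algebra F[X] L] [IsScalarTower F F[X] L] [Algebra (RatFunc F) L]
  [IsScalarTower F[X] (RatFunc F) L]

omit [IsAlgClosed L] [Algebra (RatFunc F) L] [IsScalarTower F[X] (RatFunc F) L] in
theorem aeval_algebraMap_X_eq (p : F[X]) : aeval (algebraMap F[X] L X) p = algebraMap F[X] L p := by
  rw [aeval_algebraMap_apply, aeval_X_left_apply]

omit [IsAlgClosed L] in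
theorem transcendental_X : Transcendental F (algebraMap F[X] L X) := by
  rw [transcendental_iff_injective]
  intro p q hpq
  rw [aeval_algebraMap_X_eq, aeval_algebraMap_X_eq, IsScalarTower.algebraMap_apply F[X] (RatFunc F) L,
    IsScalarTower.algebraMap_apply F[X] (RatFunc F) L] at hpq
  exact IsFractionRing.injective F[X] (RatFunc F) ((algebraMap (RatFunc F) L).injective hpq)

theorem ncard_zeros_le {Ω : Finset F} (b : Base F r Ω) (s : Setup L r (b.roots L))
    {U : F → (Fin m → Fin r) → (Fin m → Fin r) → F}
    (hU : ∀ a, S r a ≠ 0 →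
      (∀ i h, algebraMap F L (U a i h) = Setup.mon i (s.fib (algebraMap F L a) h)) ∧
      ∀ i j, ∑ h, U a i h * U a j h = gram F r m i j)
    {A : Finset F} (hA : ∀ a ∈ A, S r a ≠ 0) {n κ : ℕ} {p : (Fin m → Fin r) → F[X]} (hp0 : p ≠ 0)
    (hdeg : ∀ j, (p j).degree < ((κ + n * r : ℕ) : WithBot ℕ))
    (hp : ∀ V : ValuationSubring L, (∀ a : F[X], algebraMap F[X] L a ∈ V) → ∀ h : Fin m → Fin r,
      V.valuation (S r (algebraMap F[X] L X)) * V.valuation (value p (s.fib (algebraMap F[X] L X) h))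
        ≤ V.valuation (S r (algebraMap F[X] L X)) ^ n) :
    {x | evalMap A U p x = 0}.ncard ≤ r ^ m * (κ + r) := by
  classical
  set x := algebraMap F[X] L X with hx
  have hr := s.two_le
  have hxt : Transcendental F x := transcendental_X
  set σ : F[X] := X ^ r + X with hσ
  have hσdeg : σ.natDegree = r := by
    refine natDegree_eq_of_degree_eq_some ?_
    rw [degree_add_eq_left_of_degree_lt, degree_X_pow]
    rw [degree_X_pow, degree_X]; exact_mod_cast hr
  have hσm : σ.Monic := monic_X_pow_add (by rw [degree_X]; exact_mod_cast hr)
  have hσx : aeval x σ = S r x := by simp [hσ, S]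
  have hSx : S r x ≠ 0 := by
    rw [← hσx]
    exact fun h => hσm.ne_zero ((transcendental_iff.1 hxt) σ h)
  obtain ⟨k, M, hM⟩ := exists_mul_expansion (L := L) hr p
  have hdet := aeval_det s hSx hM
  obtain ⟨V, hVF, hVx⟩ := exists_infinite_place hxt
  have hval : ∀ h : Fin m → Fin r, value p (s.fib x h) ≠ 0 := fun h =>
    value_ne_zero V.valuation (s.isPoint_fib hSx h) hr hVx hp0
  have hdet0 : M.det ≠ 0 := fun h0 => by
    rw [h0, map_zero, eq_comm] at hdet
    exact mul_ne_zero (pow_ne_zero _ hSx) (Finset.prod_ne_zero_iff.2 fun h _ => hval h) hdet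
  have hinj : ∀ q : F[X], q ≠ 0 → V.valuation (aeval x q) = V.valuation x ^ q.natDegree :=
    fun q hq => valuation_aeval_eq_valuation_X_pow_natDegree_of_one_lt_valuation_X x hVx hq
  have hdetdeg : M.det.natDegree ≤ r * (k * r ^ m) + r ^ m * (κ + n * r) := by
    have h1 := hinj _ hdet0
    rw [hdet, map_mul, map_pow, ← hσx, hinj _ hσm.ne_zero, hσdeg, map_prod] at h1
    have h2 : ∏ h : Fin m → Fin r, V.valuation (value p (s.fib x h)) ≤
        ∏ h : Fin m → Fin r, V.valuation x ^ (κ + n * r) :=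
      Finset.prod_le_prod' fun h _ => v_value_le V.valuation (s.isPoint_fib hSx h) hr hVx hdeg
    rw [Finset.prod_const, Finset.card_univ, Fintype.card_fun, Fintype.card_fin, Fintype.card_fin,
      ← pow_mul] at h2
    have h3 := h1.symm.le.trans (mul_le_mul_right h2 _)
    rw [← pow_mul, ← pow_add, pow_le_pow_iff_right₀ hVx] at h3
    linarith
  obtain ⟨H, hH⟩ : σ ^ (n * r ^ m + k * r ^ m) ∣ σ ^ (r ^ m) * M.det := by
    refine dvd_of_valuation_le (L := L) (pow_ne_zero _ hσm.ne_zero) fun V hV => ?_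
    simp only [← aeval_algebraMap_X_eq, ← hx]
    rw [map_mul, map_pow, map_pow, hσx, hdet, map_mul, map_mul, map_pow, map_pow, map_pow, map_prod,
      pow_add, mul_left_comm, mul_comm]
    refine mul_le_mul_left ?_ _
    have h2 : ∏ h : Fin m → Fin r, V.valuation (S r x) * V.valuation (value p (s.fib x h)) ≤
        ∏ h : Fin m → Fin r, V.valuation (S r x) ^ n :=
      Finset.prod_le_prod' fun h _ => hp V hV h
    rwa [Finset.prod_mul_distrib, Finset.prod_const, Finset.prod_const, Finset.card_univ,
      Fintype.card_fun, Fintype.card_fin, Fintype.card_fin, ← pow_mul] at h2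
  have hH0 : H ≠ 0 := fun h0 => by
    rw [h0, mul_zero] at hH
    exact mul_ne_zero (pow_ne_zero _ hσm.ne_zero) hdet0 hH
  have hHdeg : H.natDegree ≤ r ^ m * (κ + r) := by
    have h1 := congrArg natDegree hH
    rw [natDegree_mul (pow_ne_zero _ hσm.ne_zero) hdet0,
      natDegree_mul (pow_ne_zero _ hσm.ne_zero) hH0, natDegree_pow, natDegree_pow, hσdeg] at h1
    nlinarith
  set c : F → (Fin m → Fin r) → F := fun a h => ∑ j, (p j).eval a * U a j h with hc
  have hz : ∀ a ∈ A, (X - C a) ^ {h | c a h = 0}.ncard ∣ H := by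
    intro a ha
    have hSa := hA a ha
    obtain ⟨hUa, hUg⟩ := hU a hSa
    have hSa' : S r (algebraMap F L a) ≠ 0 := by
      rw [← algebraMap_S]; simpa using hSa
    have hmat : M.map (eval a) * Matrix.of (U a) =
        Matrix.of (U a) * Matrix.diagonal fun h => S r a ^ k * c a h := by
      ext i h
      have := congrFun (congrFun (fibMatrix_mul s hSa' hM) i) h
      rw [Matrix.mul_diagonal] at this ⊢
      refine (algebraMap F L).injective ?_
      simp only [Matrix.mul_apply, Matrix.map_apply, fibMatrix, Matrix.of_apply, value,
        s.fib_zero, aeval_algebraMap_apply, coe_aeval_eq_eval, ← hUa] at this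
      simpa only [Matrix.mul_apply, Matrix.map_apply, Matrix.of_apply, map_sum, map_mul, map_pow,
        algebraMap_S, hc] using this
    have hdvd := X_sub_C_pow_dvd_det (det_ne_zero_of_sum_eq_gram hr hUg) hmat
    have hset : {h | S r a ^ k * c a h = 0} = {h | c a h = 0} := by
      ext h
      simp [hSa]
    rw [hset] at hdvd
    have hcop : IsCoprime ((X - C a) ^ {h | c a h = 0}.ncard) (σ ^ (n * r ^ m + k * r ^ m)) := by
      refine IsCoprime.pow ((irreducible_X_sub_C a).coprime_iff_not_dvd.2 fun h => hSa ?_)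
      rw [dvd_iff_isRoot] at h
      simpa [hσ, S] using h
    refine hcop.dvd_of_dvd_mul_left ?_
    rw [← hH]
    exact hdvd.mul_left _
  have := (sum_le_natDegree hH0 (prod_X_sub_C_pow_dvd hz)).trans hHdeg
  rw [← ncard_zeros A c] at this
  exact this

end Zeros

section Lattice

variable {F L : Type*} [Field F] [Field L] [Algebra F L] {r m : ℕ}

theorem value_add (p q : (Fin m → Fin r) → F[X]) (ξ : ℕ → L) :
    value (p + q) ξ = value p ξ + value q ξ := by
  simp only [value, Pi.add_apply, map_add, add_mul, Finset.sum_add_distrib]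

theorem value_smul (c : F[X]) (p : (Fin m → Fin r) → F[X]) (ξ : ℕ → L) :
    value (c • p) ξ = aeval (ξ 0) c * value p ξ := by
  simp only [value, Pi.smul_apply, smul_eq_mul, map_mul, mul_assoc, Finset.mul_sum]

theorem shift_mem (hr : 1 ≤ r) {i : ℕ} (him : i ≤ m) (β : F) {l : ℕ} (hl : l < m) :
    (fun ξ : Point L r => shift r i (algebraMap F L β) ξ.1 l) ∈ level F L r m := by
  have hc : (coord (l + 1) : Point L r → L) ∈ level F L r m := level_mono hl (coord_mem _)
  by_cases h : i < l + 1 ∧ l + 1 ≤ 2 * i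
  · have : (fun ξ : Point L r => shift r i (algebraMap F L β) ξ.1 l) = coord (l + 1) -
        algebraMap F (Point L r → L) (β ^ (r + 1)) *
          fun ξ : Point L r => (ξ.1 (2 * i - (l + 1)))⁻¹ := by
      funext ξ
      simp [shift, h, coord, Pi.algebraMap_apply]
    rw [this]
    exact sub_mem hc (mul_mem (Subalgebra.algebraMap_mem _ _)
      (level_mono (by omega) (inv_coord_mem hr _)))
  · have : (fun ξ : Point L r => shift r i (algebraMap F L β) ξ.1 l) = coord (l + 1) := by
      funext ξ
      simp only [shift, if_neg h, coord]
    rwa [this]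

theorem dual_mem {f : Point L r → L} (hf : f ∈ level F L r m) (j : ℕ) :
    (fun ξ => dual r j (f ξ)) ∈ level F L r m := by
  have : (fun ξ => dual r j (f ξ)) = f ^ (r - 1 - j) + if j = 0 then 1 else 0 := by
    funext ξ
    simp only [dual, Pi.add_apply, Pi.pow_apply]
    split_ifs <;> rfl
  rw [this]
  refine add_mem (pow_mem hf _) ?_
  split_ifs
  exacts [one_mem _, zero_mem _]

theorem sep_mem {i : ℕ} (him : i ≤ m) (β : F) :
    (fun ξ : Point L r => sep r i (algebraMap F L β) ξ.1) ∈ level F L r m := by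
  have : (fun ξ : Point L r => sep r i (algebraMap F L β) ξ.1) =
      ((coord i - algebraMap F (Point L r → L) β) ^ (r - 1) + 1) *
        ∏ l ∈ Finset.range i, (coord l ^ (r - 1) + 1) := by
    funext ξ
    simp [sep, coord, Pi.algebraMap_apply]
  rw [this]
  have hc : ∀ l ≤ i, (coord l : Point L r → L) ∈ level F L r m := fun l hl =>
    level_mono (hl.trans him) (coord_mem _)
  refine mul_mem (add_mem (pow_mem (sub_mem (hc i le_rfl) (Subalgebra.algebraMap_mem _ _)) _)
    (one_mem _)) (prod_mem fun l hl => add_mem (pow_mem (hc l (Finset.mem_range.1 hl).le) _)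
    (one_mem _))

theorem testFun_mem (hr : 1 ≤ r) {i : ℕ} (him : i ≤ m) (N : ℕ) (β : F) (j : Fin m → Fin r) :
    (fun ξ : Point L r => testFun r m N i (algebraMap F L β) j ξ.1) ∈ level F L r m := by
  have : (fun ξ : Point L r => testFun r m N i (algebraMap F L β) j ξ.1) =
      (fun ξ : Point L r => sep r i (algebraMap F L β) ξ.1) ^ N *
        ∏ l : Fin m, fun ξ : Point L r => dual r (j l) (shift r i (algebraMap F L β) ξ.1 l) := by
    funext ξ
    simp [testFun]
  rw [this]
  exact mul_mem (pow_mem (sep_mem him β) _)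
    (prod_mem fun l _ => dual_mem (shift_mem hr him β l.2) _)

variable [IsAlgClosed L] {Ω : Finset L}

theorem sum_value_mul_value (s : Setup L r Ω) (a : L) (p q : (Fin m → Fin r) → F[X]) :
    ∑ h : Fin m → Fin r, value p (s.fib a h) * value q (s.fib a h) =
      aeval a (pairing (gram F r m) p q) := by
  simp only [value, s.fib_zero, pairing, map_sum, map_mul, aeval_C, Finset.sum_mul_sum]
  rw [Finset.sum_comm]
  refine Finset.sum_congr rfl fun i _ => ?_
  rw [Finset.sum_comm]
  refine Finset.sum_congr rfl fun j _ => ?_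
  rw [map_gram, ← s.sum_fib a i j, Finset.sum_mul]
  exact Finset.sum_congr rfl fun h _ => by ring

omit [Algebra F L] in
theorem Setup.reproducing_fib (s : Setup L r Ω) (i : ℕ) (β a : L) (f : (Fin m → Fin r) → L)
    (h : Fin m → Fin r) :
    ∑ j : Fin m → Fin r,
      (∑ h' : Fin m → Fin r, f h' * ∏ l : Fin m, dual r (j l) (shift r i β (s.fib a h') l)) *
        ∏ l : Fin m, shift r i β (s.fib a h) l ^ (j l : ℕ) = f h := by
  have := s.reproducing i β a (fun h' => f ((s.label m).symm h')) (s.label m h)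
  simp only [← (s.label m).sum_comp, Equiv.symm_apply_apply] at this
  exact this

variable [Algebra F[X] L] [IsScalarTower F F[X] L]

/-- The polynomial combinations of monomials with poles bounded by `S ^ (N - 1)` on the generic
fibre. -/
def lattice (s : Setup L r Ω) (m N : ℕ) : Submodule F[X] ((Fin m → Fin r) → F[X]) where
  carrier := {p | ∀ V : ValuationSubring L, (∀ a : F[X], algebraMap F[X] L a ∈ V) →
    ∀ h : Fin m → Fin r,
      V.valuation (S r (algebraMap F[X] L X)) * V.valuation (value p (s.fib (algebraMap F[X] L X) h))
        ≤ V.valuation (S r (algebraMap F[X] L X)) ^ N}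
  add_mem' := by
    intro p q hp hq V hV h
    rw [value_add, ← map_mul, mul_add]
    refine (V.valuation.map_add _ _).trans (max_le ?_ ?_)
    · rw [map_mul]; exact hp V hV h
    · rw [map_mul]; exact hq V hV h
  zero_mem' := by
    intro V hV h
    simp [value]
  smul_mem' := by
    intro c p hp V hV h
    rw [value_smul, s.fib_zero, aeval_algebraMap_X_eq, map_mul, mul_left_comm]
    exact (mul_le_of_le_one_left' ((V.valuation_le_one_iff _).2 (hV c))).trans (hp V hV h)

theorem mem_lattice {s : Setup L r Ω} {N : ℕ} {p : (Fin m → Fin r) → F[X]} :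
    p ∈ lattice s m N ↔ ∀ V : ValuationSubring L, (∀ a : F[X], algebraMap F[X] L a ∈ V) →
    ∀ h : Fin m → Fin r,
      V.valuation (S r (algebraMap F[X] L X)) * V.valuation (value p (s.fib (algebraMap F[X] L X) h))
        ≤ V.valuation (S r (algebraMap F[X] L X)) ^ N := Iff.rfl

variable [Algebra (RatFunc F) L] [IsScalarTower F[X] (RatFunc F) L]

omit [IsAlgClosed L] [Algebra F L] [IsScalarTower F F[X] L] in
theorem S_X_ne_zero (hr : 2 ≤ r) : S r (algebraMap F[X] L X) ≠ 0 := by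
  have hm : (X ^ r + X : F[X]).Monic := monic_X_pow_add (by rw [degree_X]; exact_mod_cast hr)
  have : S r (algebraMap F[X] L X) = algebraMap F[X] L (X ^ r + X) := by simp [S]
  rw [this, IsScalarTower.algebraMap_apply F[X] (RatFunc F) L]
  exact (map_ne_zero_iff _ (algebraMap (RatFunc F) L).injective).2
    ((map_ne_zero_iff _ (IsFractionRing.injective F[X] (RatFunc F))).2 hm.ne_zero)

theorem mem_lattice_of_dvd (s : Setup L r Ω) {N : ℕ} (hN : Setup.sepExp r m ≤ N)
    {p : (Fin m → Fin r) → F[X]} (hp : ∀ j, (X ^ r + X) ^ (2 * N) ∣ p j) : p ∈ lattice s m N := by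
  choose q hq using hp
  have hpq : p = ((X ^ r + X) ^ (2 * N) : F[X]) • q := funext hq
  rw [mem_lattice]
  intro V hV h
  set x := algebraMap F[X] L X with hx
  have hSx : S r x ≠ 0 := S_X_ne_zero s.two_le
  set v := V.valuation
  have hpoly : ∀ a : F[X], v (aeval x a) ≤ 1 := fun a => by
    rw [aeval_algebraMap_X_eq]; exact (V.valuation_le_one_iff _).2 (hV a)
  have hx1 : v x ≤ 1 := (V.valuation_le_one_iff _).2 (hV X)
  have hS1 : v (S r x) ≤ 1 := v_S_le v hx1
  have h1 : v (value q (s.fib x h)) * v (S r x) ^ N ≤ 1 := by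
    rw [← map_pow, ← map_mul, value, Finset.sum_mul]
    refine v.map_sum_le fun j _ => ?_
    rw [mul_assoc, map_mul, map_mul, map_pow]
    refine mul_le_one' (hpoly _) ?_
    have := s.v_mon_mul_pow_le (v := v) (s.isPoint_fib hSx h) hx1 j
    exact (mul_le_mul_right (pow_le_pow_right_of_le_one' hS1 hN) _).trans this
  rw [hpq, value_smul, s.fib_zero]
  have h2 : aeval x ((X ^ r + X) ^ (2 * N) : F[X]) = S r x ^ (2 * N) := by simp [S]
  rw [h2, map_mul, map_pow, two_mul, pow_add, mul_assoc, mul_comm (v (S r x) ^ N) (v (value _ _)),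
    mul_left_comm]
  refine mul_le_of_le_one_right' ?_
  exact mul_le_one' hS1 h1

omit [IsAlgClosed L] [Algebra F[X] L] [IsScalarTower F F[X] L] [Algebra (RatFunc F) L]
  [IsScalarTower F[X] (RatFunc F) L] in
theorem exists_testFun_expansion (hr : 2 ≤ r) (ω : Finset F) (m : ℕ) :
    ∃ k, ∃ P : Fin (m + 1) × ω × (Fin m → Fin r) → (Fin m → Fin r) → F[X], ∀ t,
      ∀ ξ : ℕ → L, IsPoint r ξ →
      S r (ξ 0) ^ k * testFun r m (Setup.sepExp r m) t.1 (algebraMap F L t.2.1) t.2.2 ξ =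
        value (P t) ξ := by
  obtain ⟨k, P, hP⟩ := exists_polynomial_expansion (F := F) (L := L) hr m
    (f := fun (t : Fin (m + 1) × ω × (Fin m → Fin r)) ξ =>
      testFun r m (Setup.sepExp r m) t.1 (algebraMap F L t.2.1) t.2.2 ξ.1)
    (fun t => testFun_mem (by omega) (Nat.lt_succ_iff.1 t.1.2) _ _ _)
  exact ⟨k, P, fun t ξ hξ => hP t ⟨ξ, hξ⟩⟩

theorem exists_lattice_self_dual {ω : Finset F} (b : Base F r ω) (s : Setup L r (b.roots L))
    (m : ℕ) : ∃ N₀, ∀ N, N₀ ≤ N → ∀ q : (Fin m → Fin r) → F[X],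
      (∀ p ∈ lattice s m N, (X ^ r + X) ^ (2 * N) ∣ pairing (gram F r m) p q) →
        q ∈ lattice s m N := by
  obtain ⟨k, P, hP⟩ := exists_testFun_expansion (F := F) (L := L) s.two_le ω m
  refine ⟨k, fun N hN q hq => ?_⟩
  rw [mem_lattice]
  intro V hV h
  set x := algebraMap F[X] L X with hx
  have hSx : S r x ≠ 0 := S_X_ne_zero s.two_le
  set v := V.valuation with hv
  have hpoly : ∀ V : ValuationSubring L, (∀ a : F[X], algebraMap F[X] L a ∈ V) →
      ∀ a : F[X], V.valuation (aeval x a) ≤ 1 := fun V hV a => by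
    rw [aeval_algebraMap_X_eq]; exact (V.valuation_le_one_iff _).2 (hV a)
  have hx1 : v x ≤ 1 := (V.valuation_le_one_iff _).2 (hV X)
  have hS1 : v (S r x) ≤ 1 := v_S_le v hx1
  have hS0 : 0 < v (S r x) := zero_lt_iff.2 (v.ne_zero_iff.2 hSx)
  have hσ : ∀ n : ℕ, aeval x ((X ^ r + X) ^ n : F[X]) = S r x ^ n := fun n => by simp [S]
  rcases hS1.lt_or_eq with hlt | heq
  · obtain ⟨i, him, β', hβ', hβ0, hsep, hmon⟩ := s.exists_sep (v := v) (s.isPoint_fib hSx h) hlt m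
    obtain ⟨β, hβ, rfl⟩ := Finset.mem_map.1 hβ'
    have hinner : ∀ j : Fin m → Fin r, v (∑ h' : Fin m → Fin r,
        testFun r m (Setup.sepExp r m) i (algebraMap F L β) j (s.fib x h') *
          value q (s.fib x h')) ≤ v (S r x) ^ N := by
      intro j
      set t : Fin (m + 1) × ω × (Fin m → Fin r) := (⟨i, Nat.lt_succ_of_le him⟩, ⟨β, hβ⟩, j) with ht
      set p : (Fin m → Fin r) → F[X] := ((X ^ r + X) ^ (N - k) : F[X]) • P t with hp
      have hval : ∀ h' : Fin m → Fin r, value p (s.fib x h') = S r x ^ N *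
          testFun r m (Setup.sepExp r m) i (algebraMap F L β) j (s.fib x h') := by
        intro h'
        have := hP t _ (s.isPoint_fib hSx h')
        rw [hp, value_smul, ← this, s.fib_zero, hσ, ← mul_assoc, ← pow_add, Nat.sub_add_cancel hN]
      have hpm : p ∈ lattice s m N := by
        rw [mem_lattice]
        intro V hV h'
        rw [hval, map_mul, map_pow, mul_left_comm]
        exact mul_le_of_le_one_right' (s.v_mul_testFun_le (v := V.valuation) (s.isPoint_fib hSx h')
          ((V.valuation_le_one_iff _).2 (hV X)) hβ' hβ0 him j)
      obtain ⟨c, hc⟩ := hq p hpm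
      have h1 := sum_value_mul_value s x p q
      rw [hc, map_mul, hσ, two_mul, pow_add] at h1
      simp only [hval, mul_assoc, ← Finset.mul_sum] at h1
      rw [mul_left_cancel₀ (pow_ne_zero _ hSx) h1, map_mul, map_pow]
      exact mul_le_of_le_one_right' (hpoly V hV c)
    have hrep := s.reproducing_fib i (algebraMap F L β) x (fun h' =>
      sep r i (algebraMap F L β) (s.fib x h') ^ Setup.sepExp r m * value q (s.fib x h')) h
    have h2 : v (value q (s.fib x h)) = v (sep r i (algebraMap F L β) (s.fib x h) ^
        Setup.sepExp r m * value q (s.fib x h)) := by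
      have hsep' : v (sep r i (algebraMap F L β) (s.fib x h)) = 1 := hsep
      rw [map_mul, map_pow, hsep', one_pow, one_mul]
    have h3 : v (value q (s.fib x h)) ≤ v (S r x) ^ N * (v (S r x))⁻¹ := by
      rw [h2, ← hrep]
      refine v.map_sum_le fun j _ => ?_
      rw [map_mul]
      refine mul_le_mul' ?_ (hmon j)
      refine (congrArg v (Finset.sum_congr rfl fun h' _ => ?_)).trans_le (hinner j)
      rw [testFun]
      ring
    calc v (S r x) * v (value q (s.fib x h)) ≤ v (S r x) * (v (S r x) ^ N * (v (S r x))⁻¹) :=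
          mul_le_mul_right h3 _
      _ = v (S r x) ^ N := by rw [mul_left_comm, mul_inv_cancel₀ hS0.ne', mul_one]
  · rw [heq, one_pow, one_mul, value]
    refine v.map_sum_le fun j _ => ?_
    rw [map_mul]
    refine mul_le_one' (hpoly V hV _) ?_
    rw [Setup.mon, map_prod]
    refine Finset.prod_le_one' fun l _ => ?_
    rw [map_pow, (s.isPoint_fib hSx h).v_eq_one v s.two_le hx1 heq, one_pow]

end Lattice

theorem exists_tower_code_on_fibres {F : Type*} [Field F] [Fintype F] {p k r : ℕ} [Fact p.Prime]
    [CharP F p] (hr : r = p ^ k) (h3 : 3 ≤ r) (hcard : Fintype.card F = r * r) (m : ℕ)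
    {A : Finset F} (hA : ∀ a, a ∈ A ↔ S r a ≠ 0)
    {κ κ' : ℕ} (hκ : κ' ≤ κ) (hsum : κ + κ' = A.card) (hlt : κ + r < A.card) :
    ∃ w : A × (Fin m → Fin r) → F, (∀ i, w i ≠ 0) ∧
      ∃ C : Submodule F (A × (Fin m → Fin r) → F),
        (∀ x, (∀ y ∈ C, ∑ i, w i * x i * y i = 0) → x ∈ C) ∧ r ^ m * κ ≤ finrank F C ∧
        ∀ x ∈ C, x ≠ 0 → A.card * r ^ m ≤ r ^ m * (κ + r) + {i | x i ≠ 0}.ncard := by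
  classical
  subst hr
  have b := exists_base (F := F) hcard (by omega)
  set r := p ^ k with hr
  have s := b.setup (L := AlgebraicClosure (RatFunc F)) hr h3
  obtain ⟨U, hU⟩ := exists_fibMatrix b s m
  obtain ⟨N₀, hN₀⟩ := exists_lattice_self_dual b s m
  set N := Setup.sepExp r m + N₀ + κ with hN
  set σ : F[X] := X ^ r + X with hσ
  have hσdeg : σ.natDegree = r := by
    refine natDegree_eq_of_degree_eq_some ?_
    rw [degree_add_eq_left_of_degree_lt, degree_X_pow]
    rw [degree_X_pow, degree_X]; exact_mod_cast s.two_le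
  have hσm : σ.Monic := monic_X_pow_add (by rw [degree_X]; exact_mod_cast s.two_le)
  have hcardJ : Fintype.card (Fin m → Fin r) = r ^ m := by simp
  have hAS : ∀ a ∈ A, S r a ≠ 0 := fun a ha => (hA a).1 ha
  have := exists_code (A := A) (U := U) (G := gram F r m) (E := σ ^ (2 * N)) (e := N * r)
    (κ := κ) (κ' := κ') (Z := r ^ m * (κ + r)) (hσm.pow _) (lattice s m N)
    (fun p hp => mem_lattice_of_dvd s (by omega) hp) (hN₀ N (by omega))
    (by rw [natDegree_pow, hσdeg, mul_assoc])
    (fun a ha => by simpa [hσ, S] using fun h : a ^ r + a = 0 => absurd h (hAS a ha))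
    (fun a ha => (hU a (hAS a ha)).2) hκ
    ((by omega : κ ≤ N).trans (Nat.le_mul_of_pos_right _ (by omega))) hsum
    (by
      rw [hcardJ, mul_comm]
      exact Nat.mul_lt_mul_of_pos_right hlt (by positivity))
    (fun p hp hp0 hpd => ncard_zeros_le b s hU hAS hp0 (mem_degV.1 hpd) hp)
  rwa [hcardJ] at this

theorem exists_reindex {F ι ι' : Type*} [Field F] [Fintype ι] [Fintype ι'] (e : ι ≃ ι') {a b c : ℕ}
    (h : ∃ w : ι → F, (∀ i, w i ≠ 0) ∧ ∃ C : Submodule F (ι → F),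
      (∀ x, (∀ y ∈ C, ∑ i, w i * x i * y i = 0) → x ∈ C) ∧ a ≤ finrank F C ∧
        ∀ x ∈ C, x ≠ 0 → b ≤ c + {i | x i ≠ 0}.ncard) :
    ∃ w : ι' → F, (∀ i, w i ≠ 0) ∧ ∃ C : Submodule F (ι' → F),
      (∀ x, (∀ y ∈ C, ∑ i, w i * x i * y i = 0) → x ∈ C) ∧ a ≤ finrank F C ∧
        ∀ x ∈ C, x ≠ 0 → b ≤ c + {i | x i ≠ 0}.ncard := by
  obtain ⟨w, hw, C, hdual, hdim, hwt⟩ := h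
  set f : (ι' → F) ≃ₗ[F] (ι → F) := LinearEquiv.funCongrLeft F F e
  have hfx : ∀ x i, f x i = x (e i) := fun x i => rfl
  refine ⟨fun i => w (e.symm i), fun i => hw _, C.comap f.toLinearMap, fun x hx => ?_, ?_,
    fun x hx hx0 => ?_⟩
  · refine hdual (f x) fun y hy => ?_
    have := hx (f.symm y) (by simpa using hy)
    rw [← e.sum_comp] at this
    rw [← this]
    refine Finset.sum_congr rfl fun i _ => ?_
    change _ = w (e.symm (e i)) * x (e i) * f (f.symm y) i
    rw [e.symm_apply_apply, f.apply_symm_apply, hfx]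
  · have h := Submodule.map_equiv_eq_comap_symm f.symm C
    rw [LinearEquiv.symm_symm] at h
    change a ≤ finrank F (C.comap (f : (ι' → F) →ₗ[F] (ι → F)))
    rwa [← h, LinearEquiv.finrank_map_eq]
  · have h1 := hwt (f x) hx (by simpa using hx0)
    have h2 : {i | f x i ≠ 0}.ncard = {i | x i ≠ 0}.ncard := by
      rw [← Set.ncard_image_of_injective _ e.injective]
      congr 1
      ext i
      simp only [Set.mem_image, Set.mem_ofPred_eq, hfx]
      exact ⟨fun ⟨j, hj, hji⟩ => hji ▸ hj, fun h => ⟨e.symm i, by simpa using h, by simp⟩⟩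
    rwa [h2] at h1

theorem exists_tower_code {F : Type*} [Field F] [Fintype F] {p k r : ℕ} [Fact p.Prime]
    [CharP F p] (hr : r = p ^ k) (h3 : 3 ≤ r) (hcard : Fintype.card F = r * r) (m : ℕ)
    {κ κ' : ℕ} (hκ : κ' ≤ κ) (hsum : κ + κ' = r * r - r) (hlt : κ + r < r * r - r) :
    ∃ w : Fin ((r * r - r) * r ^ m) → F, (∀ i, w i ≠ 0) ∧
      ∃ C : Submodule F (Fin ((r * r - r) * r ^ m) → F),
        (∀ x, (∀ y ∈ C, ∑ i, w i * x i * y i = 0) → x ∈ C) ∧ r ^ m * κ ≤ finrank F C ∧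
        ∀ x ∈ C, x ≠ 0 → (r * r - r) * r ^ m ≤ r ^ m * (κ + r) + {i | x i ≠ 0}.ncard := by
  classical
  set A : Finset F := Finset.univ.filter fun a => S r a ≠ 0 with hA
  have hAcard : A.card = r * r - r := by
    have b := exists_base (F := F) (p := p) (k := k) (by rw [hcard, hr]) (by omega)
    have h1 := Finset.card_filter_add_card_filter_not (s := (Finset.univ : Finset F))
      fun a => S r a = 0
    have h2 := b.card
    rw [← hr] at h2
    rw [h2, Finset.card_univ, hcard] at h1
    change r + A.card = r * r at h1
    omega
  have e : A × (Fin m → Fin r) ≃ Fin ((r * r - r) * r ^ m) :=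
    Fintype.equivFinOfCardEq (by simp [hAcard])
  refine exists_reindex e ?_
  have := exists_tower_code_on_fibres hr h3 hcard m (A := A) (fun a => by simp [hA]) hκ
    (by rwa [hAcard]) (by rwa [hAcard])
  rwa [hAcard] at this

theorem exists_rate {r : ℕ} (hr : 4 < r) {α : ℝ} (hα1 : 2 / ((r : ℝ) - 2) < α)
    (hα2 : α < 1 / 2 + 1 / ((r : ℝ) - 2)) :
    ∃ κ κ' : ℕ, κ' ≤ κ ∧ κ + κ' = r * r - r ∧ κ + r < r * r - r ∧
      (1 - α + 1 / ((r : ℝ) - 2)) * (r * r - r : ℕ) ≤ κ ∧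
      (α - 2 / ((r : ℝ) - 2)) * (r * r - r : ℕ) ≤ (r * r - r : ℕ) - ((κ : ℝ) + r) := by
  have hr4 : (4 : ℝ) < r := by exact_mod_cast hr
  have hle : r ≤ r * r := Nat.le_mul_self r
  have hn : ((r * r - r : ℕ) : ℝ) = r * r - r := by push_cast [Nat.cast_sub hle]; ring
  set R : ℝ := 1 - α + 1 / ((r : ℝ) - 2) with hR
  set n : ℝ := (r : ℝ) * r - r with hn0
  have hnpos : 0 < n := by nlinarith
  have hRhalf : 1 / 2 < R := by linarith
  have h1 : R * n ≤ ⌈R * n⌉₊ := Nat.le_ceil _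
  have h2 : (⌈R * n⌉₊ : ℝ) < R * n + 1 := Nat.ceil_lt_add_one (by positivity)
  have h3 : (r : ℝ) + 1 ≤ 1 / ((r : ℝ) - 2) * n := by
    rw [one_div, ← div_eq_inv_mul, le_div_iff₀ (by linarith)]
    nlinarith
  have h4 : (α - 2 / ((r : ℝ) - 2)) * n = n - (R * n + 1 / ((r : ℝ) - 2) * n) := by
    rw [hR]; ring
  have h5 : (α - 2 / ((r : ℝ) - 2)) * n ≤ n - ((⌈R * n⌉₊ : ℝ) + r) := by linarith
  have h6 : 0 < (α - 2 / ((r : ℝ) - 2)) * n := mul_pos (by linarith) hnpos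
  have h7 : ⌈R * n⌉₊ + r < r * r - r := by
    have : ((⌈R * n⌉₊ + r : ℕ) : ℝ) < ((r * r - r : ℕ) : ℝ) := by
      rw [hn]; push_cast; linarith
    exact_mod_cast this
  refine ⟨⌈R * n⌉₊, r * r - r - ⌈R * n⌉₊, ?_, by omega, h7, by rwa [hn], by rwa [hn]⟩
  have : ((r * r - r : ℕ) : ℝ) ≤ ((2 * ⌈R * n⌉₊ : ℕ) : ℝ) := by
    rw [hn]; push_cast; nlinarith
  have : r * r - r ≤ 2 * ⌈R * n⌉₊ := by exact_mod_cast this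
  omega

end GSTower

/-- Asymptotic existence of AG codes containing their twisted duals
(Corollary to Theorem 4): over `𝔽_q`, `q = p^(2s)`, `√q = p^s > 4`, for
`2/(√q−2) < α < 1/2 + 1/(√q−2)` there are codes of length `n → ∞` with
`C_w^⊥ ⊆ C`, rate `≥ 1 − α + 1/(√q−2) − ε` and relative distance
`≥ α − 2/(√q−2) − ε`. -/
theorem ag_codes_twisted_selfdual
    (p s : ℕ) (hp : p.Prime) (hs : 4 < p ^ s)
    (K : Type*) [Field K] [Fintype K] (hcard : Fintype.card K = p ^ (2 * s))
    (α : ℝ) (hα1 : 2 / ((p : ℝ) ^ s - 2) < α)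
    (hα2 : α < 1 / 2 + 1 / ((p : ℝ) ^ s - 2)) :
    ∀ ε : ℝ, 0 < ε → ∀ N : ℕ, ∃ n : ℕ, N ≤ n ∧
      ∃ w : Fin n → K, (∀ i, w i ≠ 0) ∧
      ∃ C : Submodule K (Fin n → K),
        (∀ x : Fin n → K, (∀ y ∈ C, ∑ i, w i * x i * y i = 0) → x ∈ C) ∧
        (1 - α + 1 / ((p : ℝ) ^ s - 2) - ε) * n ≤ (Module.finrank K C : ℝ) ∧
        ∀ x ∈ C, x ≠ (0 : Fin n → K) →
          (α - 2 / ((p : ℝ) ^ s - 2) - ε) * n ≤ ({i | x i ≠ 0}.ncard : ℝ) := by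
  intro ε hε N
  have : Fact p.Prime := ⟨hp⟩
  have : CharP K p := charP_of_card_eq_prime_pow hcard
  obtain ⟨r, hr⟩ : ∃ r, r = p ^ s := ⟨_, rfl⟩
  have hrR : (p : ℝ) ^ s = r := by rw [hr]; push_cast; rfl
  rw [hrR] at hα1 hα2 ⊢
  rw [← hr] at hs
  obtain ⟨κ, κ', hκ, hsum, hlt, hrate, hdist⟩ := GSTower.exists_rate hs hα1 hα2
  obtain ⟨w, hw, C, hdual, hdim, hwt⟩ := GSTower.exists_tower_code hr (by omega)
    (by rw [hcard, hr, two_mul, pow_add]) N hκ hsum hlt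
  have hpow : (0 : ℝ) < (r : ℝ) ^ N := pow_pos (by exact_mod_cast (by omega : 0 < r)) _
  refine ⟨_, ?_, w, hw, C, hdual, ?_, fun x hx hx0 => ?_⟩
  · exact (Nat.lt_pow_self (by omega)).le.trans (Nat.le_mul_of_pos_left _ (by omega))
  · have h1 : ((r ^ N * κ : ℕ) : ℝ) ≤ Module.finrank K C := by exact_mod_cast hdim
    refine le_trans ?_ h1
    have h2 := mul_le_mul_of_nonneg_right hrate hpow.le
    have h3 : 0 ≤ ε * (((r * r - r) * r ^ N : ℕ) : ℝ) := by positivity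
    rw [sub_mul]
    simp only [Nat.cast_mul, Nat.cast_pow] at h3 ⊢
    linarith
  · have h1 : (((r * r - r) * r ^ N : ℕ) : ℝ) ≤
        ((r ^ N * (κ + r) + {i | x i ≠ 0}.ncard : ℕ) : ℝ) := by exact_mod_cast hwt x hx hx0
    have h2 := mul_le_mul_of_nonneg_right hdist hpow.le
    have h3 : 0 ≤ ε * (((r * r - r) * r ^ N : ℕ) : ℝ) := by positivity
    rw [sub_mul _ ε]
    simp only [Nat.cast_mul, Nat.cast_pow, Nat.cast_add] at h1 h3 ⊢
    linarith
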